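/- Let g ≥ 0 and n ≥ 1. Then: (i) [L_g^{0,0}(y,x_1,…,x_n)]_{y^{2g−2}} = 0, i.e. the coefficient of y^{2g−2} times any monomial in x vanishes; (ii) for every integer k > 2g, [L_g^{2,2}(y,x_1,…,x_n)]_{y^k} = 0; (iii) if d_1,…,d_n ≥ 1 are integers with Σ_{j=1}^n d_j = g+n, then [L_g^{2,2}(y,x_1,…,x_n)]_{y^{2g} Π_{j=1}^n x_j^{d_j}} = (2g+n+1)!/(4^g (2g+1)! Π_{j=1}^n (2d_j−1)!!). -/

import Mathlib

open MvPolynomial Finset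

noncomputable section

/-- The polynomial ring `ℚ[x_1,…,x_n]`. -/
abbrev R (n : ℕ) : Type := MvPolynomial (Fin n) ℚ

/-- The field of rational functions `ℚ(x_1,…,x_n)`. -/
abbrev K (n : ℕ) : Type := FractionRing (R n)

/-- `x_1 + ⋯ + x_n` as an element of `K n`. -/
def SX (n : ℕ) : K n := algebraMap (R n) (K n) (∑ j, X j)

/-- `x_1^3 + ⋯ + x_n^3` as an element of `K n`. -/
def SX3 (n : ℕ) : K n := algebraMap (R n) (K n) (∑ j, (X j)^3)

/-- `Δ(x_1,…,x_n) = ((Σ x_j)^3 − Σ x_j^3)/3`. -/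
def Dlt (n : ℕ) : K n := ((SX n)^3 - SX3 n) / 3

/-- The ring homomorphism `ℚ[x_1,…,x_{|I|}] → ℚ(x_1,…,x_n)` substituting the variables
of the subset `I` (in increasing order). -/
def embRH {n : ℕ} (I : Finset (Fin n)) : R I.card →+* K n :=
  (algebraMap (R n) (K n)).comp
    (MvPolynomial.rename (fun i : Fin I.card => ((I.orderIsoOfFin rfl) i : Fin n))).toRingHom

lemma embRH_inj {n : ℕ} (I : Finset (Fin n)) : Function.Injective (embRH I) := by
  have h1 : Function.Injective (fun i : Fin I.card => ((I.orderIsoOfFin rfl) i : Fin n)) := by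
    intro i j hij
    exact (I.orderIsoOfFin rfl).injective (Subtype.val_injective hij)
  have h2 := (IsFractionRing.injective (R n) (K n)).comp (MvPolynomial.rename_injective _ h1)
  simpa [embRH, RingHom.coe_comp] using h2

/-- The field embedding `ℚ(x_1,…,x_{|I|}) → ℚ(x_1,…,x_n)` substituting the variables
of the subset `I` (in increasing order).  Used for expressions like `G_{r'}(x_I)`. -/
def emb {n : ℕ} (I : Finset (Fin n)) : K I.card →+* K n :=
  IsFractionRing.lift (embRH_inj I)

/-- The normalized `n`-point functions `G_g(x_1,…,x_n)`, defined with a fuel parameter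
(first argument) for structural recursion; for `fuel ≥ n` this computes the recursively
defined normalized `n`-point function:  `G_0(x) = x^{-2}`, `G_g(x) = 0` for `g ≥ 1`, and
for `n ≥ 2`,
`G_g = Σ_{r+s=g} ((2r+n−3)!!/(4^s(2r+2s+n−1)!!)) P_r Δ^s` where
`P_r = (1/(2Σx_j)) Σ_{I⊔J={1..n}, I,J≠∅} (Σ_I x)²(Σ_J x)² Σ_{r'≤r} G_{r'}(x_I)G_{r−r'}(x_J)`. -/
def Gf : (fuel : ℕ) → (n : ℕ) → ℕ → K n
  | _, 0, _ => 0
  | _, 1, 0 => (algebraMap (R 1) (K 1) (X 0)) ^ (-2 : ℤ)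
  | _, 1, _+1 => 0
  | 0, _+2, _ => 0
  | fuel+1, n+2, g =>
      ∑ s ∈ Finset.range (g+1),
        (((Nat.doubleFactorial (2*(g-s)+(n+2)-3) : ℚ) /
          (4^s * (Nat.doubleFactorial (2*g+(n+2)-1) : ℚ))) : K (n+2)) *
        ((2 * SX (n+2))⁻¹ *
          ∑ I : Finset (Fin (n+2)),
            if I ≠ ∅ ∧ I ≠ univ then
              (algebraMap (R (n+2)) (K (n+2)) (∑ i ∈ I, X i))^2 *
              (algebraMap (R (n+2)) (K (n+2)) (∑ i ∈ Iᶜ, X i))^2 *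
              ∑ r' ∈ Finset.range ((g-s)+1),
                emb I (Gf fuel I.card r') * emb Iᶜ (Gf fuel Iᶜ.card ((g-s) - r'))
            else 0) *
        (Dlt (n+2))^s

/-- The normalized `n`-point function `G_g(x_1,…,x_n)` as an element of `ℚ(x_1,…,x_n)`. -/
def Gnpt (n g : ℕ) : K n := Gf n n g

/-- `P_r(x_1,…,x_n)`. -/
def Ppoly (n r : ℕ) : K n :=
  (2 * SX n)⁻¹ *
    ∑ I : Finset (Fin n),
      if I ≠ ∅ ∧ I ≠ univ then
        (algebraMap (R n) (K n) (∑ i ∈ I, X i))^2 *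
        (algebraMap (R n) (K n) (∑ i ∈ Iᶜ, X i))^2 *
        ∑ r' ∈ Finset.range (r+1), emb I (Gnpt I.card r') * emb Iᶜ (Gnpt Iᶜ.card (r - r'))
      else 0

/-- The `n`-point function `F_g(x_1,…,x_n) = Σ_{h+d=g} (1/d!)((Σx_j^3)/24)^d G_h(x_1,…,x_n)`. -/
def Fnpt (n g : ℕ) : K n :=
  ∑ d ∈ Finset.range (g+1),
    ((1 / (Nat.factorial d : ℚ)) : K n) * (SX3 n / 24)^d * Gnpt n (g-d)

open Classical in
/-- The coefficient of the monomial `Π x_j^{d_j}` of an element of `ℚ(x_1,…,x_n)` which is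
a polynomial (junk value `0` otherwise). -/
def coeffK {n : ℕ} (f : K n) (d : Fin n → ℕ) : ℚ :=
  if h : ∃ p : R n, algebraMap (R n) (K n) p = f then
    MvPolynomial.coeff (Finsupp.equivFunOnFinite.symm d) h.choose
  else 0

/-- The intersection index `⟨τ_{d_1} ⋯ τ_{d_n}⟩_g`, i.e. the coefficient of `Π x_j^{d_j}`
in `F_g(x_1,…,x_n)`.  For `(g,n) = (0,1), (0,2)` and nonnegative `d_j` the value is `0`
(the conventional values `⟨τ_{-2}⟩_0 = 1`, `⟨τ_k τ_{-1-k}⟩_0 = (-1)^k` have a negative index). -/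
def bracket (g : ℕ) {n : ℕ} (d : Fin n → ℕ) : ℚ :=
  if g = 0 ∧ n ≤ 2 then 0 else coeffK (Fnpt n g) d

/-- `⟨τ_j Π_{i ∈ I} τ_{d_i}⟩_g` for a subset `I ⊆ {1,…,n}`. -/
def bracketI (g : ℕ) {n : ℕ} (j : ℕ) (I : Finset (Fin n)) (d : Fin n → ℕ) : ℚ :=
  bracket g (Fin.cons j (fun i : Fin I.card => d ((I.orderIsoOfFin rfl) i)))


/-! ### Laurent expansions in `y` (formal series in `ℚ[x_1,…,x_n][[y,y⁻¹]]` of bounded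
`y`-degree, realized as Hahn/Laurent series in the variable `t = y⁻¹`, so that the
coefficient of `y^k` is the Hahn coefficient at `-k`). -/

/-- Laurent series in `t = y⁻¹` with coefficients in `ℚ[x_1,…,x_n]`. -/
abbrev Lau (n : ℕ) : Type := LaurentSeries (R n)

/-- The generalized binomial coefficient `C(p,k) = p(p−1)⋯(p−k+1)/k!` for `p : ℤ`, `k : ℕ`. -/
def binomZ (p : ℤ) (k : ℕ) : ℚ := (∏ i ∈ Finset.range k, ((p : ℚ) - i)) / (Nat.factorial k)

/-- The expansion of `(y + c)^m = Σ_{k≥0} C(m,k) c^k y^{m−k}` as a Laurent series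
in `t = y⁻¹` (for `m ≥ 0` this is the usual binomial expansion of the polynomial). -/
def yExpAdd {n : ℕ} (c : R n) (m : ℤ) : Lau n :=
  (HahnSeries.single (-m) (1 : R n)) *
    HahnSeries.ofPowerSeries ℤ (R n)
      (PowerSeries.mk fun k => MvPolynomial.C (binomZ m k) * c^k)

/-- The expansion of `(±y + c)^m`, where the sign is `+` if `σ = true` and `−` otherwise;
it is computed as `(±1)^m (y ± c)^m`. -/
def LExp {n : ℕ} (σ : Bool) (c : R n) (m : ℤ) : Lau n :=
  (if σ then 1 else if Even m then 1 else -1 : Lau n) *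
    yExpAdd ((if σ then 1 else -1 : R n) * c) m

open Classical in
/-- The polynomial representing an element of `ℚ(x_1,…,x_n)` lying in `ℚ[x_1,…,x_n]`
(junk value `0` otherwise). -/
def polyOf {n : ℕ} (f : K n) : R n :=
  if h : ∃ p : R n, algebraMap (R n) (K n) p = f then h.choose else 0

/-- `±y` as a Laurent series in `t = y⁻¹`. -/
def yLau (n : ℕ) (σ : Bool) : Lau n :=
  (if σ then 1 else -1 : Lau n) * HahnSeries.single (-1 : ℤ) (1 : R n)

/-- The expansion of `F_g(±y, x_I)` as a Laurent series in `t = y⁻¹` with coefficients in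
`ℚ[x_1,…,x_n]`: for `(g,|I|+1) = (0,1)` it is `(±y)^{-2} = y^{-2}`, for `(g,|I|+1) = (0,2)`
it is `1/(±y + x_i) = Σ_{k≥0} (−1)^k x_i^k (±y)^{−k−1}`, and otherwise it is obtained by
substituting `±y` and the variables of `I` into the polynomial `F_g`. -/
def FExp {n : ℕ} (σ : Bool) (g : ℕ) (I : Finset (Fin n)) : Lau n :=
  if g = 0 ∧ I.card = 0 then HahnSeries.single (2 : ℤ) (1 : R n)
  else if g = 0 ∧ I.card = 1 then LExp σ (∑ i ∈ I, X i) (-1)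
  else
    MvPolynomial.eval₂ ((HahnSeries.C).comp (algebraMap ℚ (R n)))
      (Fin.cons (yLau n σ)
        (fun i : Fin I.card => HahnSeries.C (X ((I.orderIsoOfFin rfl) i : Fin n))))
      (polyOf (Fnpt (I.card + 1) g))

/-- `L_g^{a,b}(y, x_1,…,x_n) = Σ_{g'=0}^{g} Σ_{I⊔J={1,…,n}} (y+Σ_I x)^a (−y+Σ_J x)^b
F_{g'}(y,x_I) F_{g−g'}(−y,x_J)` as a Laurent series in `t = y⁻¹`. -/
def LL (g n : ℕ) (a b : ℤ) : Lau n :=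
  ∑ gp ∈ Finset.range (g+1), ∑ I : Finset (Fin n),
    LExp true (∑ i ∈ I, X i) a * LExp false (∑ i ∈ Iᶜ, X i) b *
      FExp true gp I * FExp false (g - gp) Iᶜ

/-- The coefficient of `y^k Π_j x_j^{d_j}` in a Laurent series in `t = y⁻¹` with coefficients
in `ℚ[x_1,…,x_n]`. -/
def coeffL {n : ℕ} (f : Lau n) (k : ℤ) (d : Fin n → ℕ) : ℚ :=
  MvPolynomial.coeff (Finsupp.equivFunOnFinite.symm d) (f.coeff (-k))

/-- The index of the variable `z_i` among the `a + b + n` variables `z, w, x`. -/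
def zIdx (a b n : ℕ) (i : Fin a) : Fin (a+b+n) := ⟨i.1, by have := i.2; omega⟩

/-- The index of the variable `w_i` among the `a + b + n` variables `z, w, x`. -/
def wIdx (a b n : ℕ) (i : Fin b) : Fin (a+b+n) := ⟨a + i.1, by have := i.2; omega⟩

/-- The index of the variable `x_i` among the `a + b + n` variables `z, w, x`. -/
def xIdx (a b n : ℕ) (i : Fin n) : Fin (a+b+n) := ⟨a + b + i.1, by have := i.2; omega⟩

/-- `L_g(y; z_1,…,z_a; w_1,…,w_b; x_1,…,x_n)
 = Σ_{g'=0}^{g} Σ_{I⊔J={1,…,n}} F_{g'}(y, z, x_I) F_{g−g'}(−y, w, x_J)`,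
as a Laurent series in `t = y⁻¹` with coefficients in `ℚ[z,w,x]`. -/
def LLm (g n a b : ℕ) : Lau (a+b+n) :=
  ∑ gp ∈ Finset.range (g+1), ∑ I : Finset (Fin n),
    FExp true gp ((univ.image (zIdx a b n)) ∪ I.image (xIdx a b n)) *
    FExp false (g - gp) ((univ.image (wIdx a b n)) ∪ Iᶜ.image (xIdx a b n))

/-- The exponent vector of the monomial `Π z_j^{r_j} Π w_j^{s_j} Π x_j^{d_j}`. -/
def expVec (a b n : ℕ) (r : Fin a → ℕ) (s : Fin b → ℕ) (d : Fin n → ℕ) :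
    Fin (a+b+n) → ℕ :=
  fun v =>
    if h : v.1 < a then r ⟨v.1, h⟩
    else if h2 : v.1 < a + b then s ⟨v.1 - a, by omega⟩
    else d ⟨v.1 - (a+b), by have := v.2; omega⟩

set_option linter.unusedSectionVars false

section SetConvolution

variable {ι ι' B : Type*} [DecidableEq ι] [DecidableEq ι'] [CommRing B]

/-- The set convolution `(f ⋆ g)(S) = Σ_{S = I ⊔ J} f(I) g(J)`. -/
def conv (f g : Finset ι → B) (S : Finset ι) : B := ∑ I ∈ S.powerset, f I * g (S \ I)

lemma conv_comm (f g : Finset ι → B) : conv f g = conv g f := by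
  funext S
  refine Finset.sum_nbij' (fun I => S \ I) (fun I => S \ I) ?_ ?_ ?_ ?_ ?_ <;>
    simp +contextual [mul_comm]

lemma conv_assoc (f g h : Finset ι → B) : conv (conv f g) h = conv f (conv g h) := by
  funext S
  simp only [conv, Finset.sum_mul, Finset.mul_sum]
  rw [Finset.sum_sigma', Finset.sum_sigma']
  refine Finset.sum_nbij' (fun p => ⟨p.2, p.1 \ p.2⟩) (fun p => ⟨p.1 ∪ p.2, p.1⟩) ?_ ?_ ?_ ?_ ?_
  · rintro ⟨I, J⟩ h
    simp only [mem_sigma, mem_powerset] at h ⊢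
    exact ⟨h.2.trans h.1, sdiff_subset_sdiff h.1 le_rfl⟩
  · rintro ⟨I, J⟩ h
    simp only [mem_sigma, mem_powerset] at h ⊢
    exact ⟨union_subset h.1 (h.2.trans sdiff_subset), subset_union_left⟩
  · rintro ⟨I, J⟩ h
    simp only [mem_sigma, mem_powerset] at h ⊢
    rw [union_sdiff_of_subset h.2]
  · rintro ⟨I, J⟩ h
    simp only [mem_sigma, mem_powerset] at h ⊢
    rw [union_sdiff_cancel_left]
    exact disjoint_of_subset_right h.2 disjoint_sdiff
  · rintro ⟨I, J⟩ h
    simp only [mem_sigma, mem_powerset] at h ⊢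
    have : (S \ J) \ (I \ J) = S \ I := by grind
    rw [mul_assoc, this]

lemma conv_add_left (f g h : Finset ι → B) : conv (f + g) h = conv f h + conv g h := by
  funext S
  simp [conv, add_mul, Finset.sum_add_distrib]

lemma conv_add_right (f g h : Finset ι → B) : conv f (g + h) = conv f g + conv f h := by
  funext S
  simp [conv, mul_add, Finset.sum_add_distrib]

lemma conv_const_mul_left (b : B) (f g : Finset ι → B) :
    conv (fun S => b * f S) g = fun S => b * conv f g S := by
  funext S
  simp [conv, mul_assoc, Finset.mul_sum]

lemma conv_const_mul_right (b : B) (f g : Finset ι → B) :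
    conv f (fun S => b * g S) = fun S => b * conv f g S := by
  rw [conv_comm, conv_const_mul_left, conv_comm]

/-- Multiplication by an additive weight is a derivation of the set convolution. -/
lemma sum_mul_conv (v : ι → B) (f g : Finset ι → B) (S : Finset ι) :
    (∑ i ∈ S, v i) * conv f g S =
      conv (fun I => (∑ i ∈ I, v i) * f I) g S + conv f (fun J => (∑ i ∈ J, v i) * g J) S := by
  simp only [conv, Finset.mul_sum, ← Finset.sum_add_distrib]
  refine Finset.sum_congr rfl fun I hI => ?_
  rw [← Finset.sum_sdiff (mem_powerset.1 hI)]
  ring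

lemma conv_congr {f f' g g' : Finset ι → B} {S : Finset ι} (hf : ∀ I ⊆ S, f I = f' I)
    (hg : ∀ I ⊆ S, g I = g' I) : conv f g S = conv f' g' S :=
  Finset.sum_congr rfl fun I hI => by
    rw [hf I (mem_powerset.1 hI), hg _ sdiff_subset]

lemma conv_insert (f g : Finset ι → B) {S : Finset ι} {i : ι} (hi : i ∉ S) :
    conv f g (insert i S) =
      conv (fun I => f (insert i I)) g S + conv f (fun J => g (insert i J)) S := by
  rw [conv, Finset.sum_powerset_insert hi, add_comm]
  congr 1 <;> refine Finset.sum_congr rfl fun I hI => ?_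
  · rw [insert_sdiff_insert, sdiff_insert_of_notMem hi]
  · have : i ∉ I := fun h => hi (mem_powerset.1 hI h)
    rw [insert_sdiff_of_notMem _ this]

lemma conv_map (f : ι ↪ ι') (F G : Finset ι' → B) (S : Finset ι) :
    conv F G (S.map f) = conv (fun I => F (I.map f)) (fun I => G (I.map f)) S := by
  symm
  refine Finset.sum_nbij (fun I => I.map f) ?_ ?_ ?_ ?_
  · intro I hI
    simpa using hI
  · intro I _ J _ h
    exact Finset.map_injective f h
  · intro I hI
    simp only [coe_powerset, Set.mem_preimage, Set.mem_powerset_iff, coe_subset] at hI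
    obtain ⟨J, hJ, rfl⟩ := Finset.subset_map_iff.1 hI
    exact ⟨J, by simpa using hJ, rfl⟩
  · intro I _
    simp only [Finset.map_sdiff]

lemma map_conv {B' : Type*} [CommRing B'] (φ : B →+* B') (f g : Finset ι → B) (S : Finset ι) :
    φ (conv f g S) = conv (fun I => φ (f I)) (fun I => φ (g I)) S := by
  simp [conv]

end SetConvolution

section Euler

variable {ι A : Type*} [CommRing A]

/-- The Euler operator `t d/dt` on power series in `t`. -/
def theta (f : PowerSeries A) : PowerSeries A := PowerSeries.X * PowerSeries.derivative A f

@[simp] lemma coeff_theta (g : ℕ) (f : PowerSeries A) :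
    PowerSeries.coeff g (theta f) = g * PowerSeries.coeff g f := by
  cases g with
  | zero => simp [theta]
  | succ g => simp [theta, PowerSeries.coeff_succ_X_mul, PowerSeries.coeff_derivative, mul_comm]

lemma theta_mul (f h : PowerSeries A) : theta (f * h) = theta f * h + f * theta h := by
  simp only [theta, Derivation.leibniz, smul_eq_mul]
  ring

lemma theta_C_mul (a : A) (f : PowerSeries A) :
    theta (PowerSeries.C a * f) = PowerSeries.C a * theta f := by
  ext g
  simp
  ring

lemma theta_sum {κ : Type*} (s : Finset κ) (f : κ → PowerSeries A) :
    theta (∑ k ∈ s, f k) = ∑ k ∈ s, theta (f k) := by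
  simp [theta, Finset.mul_sum]

lemma theta_add (f h : PowerSeries A) : theta (f + h) = theta f + theta h := by
  simp [theta, mul_add]

lemma theta_sub (f h : PowerSeries A) : theta (f - h) = theta f - theta h := by
  simp [theta, mul_sub]

lemma theta_C (a : A) : theta (PowerSeries.C a) = 0 := by
  simp [theta]

lemma theta_X : theta (PowerSeries.X : PowerSeries A) = PowerSeries.X := by
  simp [theta]

lemma theta_natCast (n : ℕ) : theta (n : PowerSeries A) = 0 := by
  simp [theta]

lemma theta_ofNat (n : ℕ) [n.AtLeastTwo] : theta (ofNat(n) : PowerSeries A) = 0 :=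
  theta_natCast n

/-- The operator `2 t d/dt + |S|` on families of power series indexed by finite sets. -/
def eul (f : Finset ι → PowerSeries A) (S : Finset ι) : PowerSeries A :=
  2 * theta (f S) + S.card * f S

lemma coeff_eul (f : Finset ι → PowerSeries A) (S : Finset ι) (g : ℕ) :
    PowerSeries.coeff g (eul f S) = ((2 * g + S.card : ℕ) : A) * PowerSeries.coeff g (f S) := by
  have h2 : (2 : PowerSeries A) = PowerSeries.C 2 := (map_ofNat _ 2).symm
  have h3 : (S.card : PowerSeries A) = PowerSeries.C (S.card : A) := (map_natCast _ _).symm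
  rw [eul, h2, h3, map_add, PowerSeries.coeff_C_mul, PowerSeries.coeff_C_mul, coeff_theta]
  push_cast
  ring

/-- The operator `2 t d/dt + |S|` is a derivation of the set convolution. -/
lemma eul_conv [DecidableEq ι] (f h : Finset ι → PowerSeries A) :
    eul (conv f h) = conv (eul f) h + conv f (eul h) := by
  funext S
  simp only [eul, conv, Pi.add_apply, theta_sum, Finset.mul_sum, ← Finset.sum_add_distrib]
  refine Finset.sum_congr rfl fun I hI => ?_
  rw [theta_mul, ← Finset.card_sdiff_add_card_eq_card (mem_powerset.1 hI)]
  push_cast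
  ring

lemma eul_C_mul (a : Finset ι → A) (f : Finset ι → PowerSeries A) :
    eul (fun S => PowerSeries.C (a S) * f S) = fun S => PowerSeries.C (a S) * eul f S := by
  funext S
  simp only [eul, theta_C_mul]
  ring

end Euler

section PointFunction

variable {ι ι' A A' : Type*} [DecidableEq ι] [DecidableEq ι'] [CommRing A] [Algebra ℚ A]
  [CommRing A'] [Algebra ℚ A']

/-- The polynomial `(Σ_{i ∈ S} v_i)^2 F_g(v_S)`, where `F_g` is the `n`-point function. -/
def ptH (v : ι → A) (S : Finset ι) (g : ℕ) : A :=
  if S.card = 0 then 0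
  else if S.card = 1 ∧ g = 0 then 1
  else algebraMap ℚ A (12 * (2 * g + S.card - 1))⁻¹ *
    ((if 0 < g then (∑ i ∈ S, v i) ^ 3 * ptH v S (g - 1) else 0) +
      6 * (∑ i ∈ S, v i) * ∑ I ∈ S.powerset, ∑ p ∈ antidiagonal g,
        if I.card < S.card ∧ (S \ I).card < S.card then ptH v I p.1 * ptH v (S \ I) p.2 else 0)
termination_by (S.card, g)
decreasing_by
  · exact Prod.Lex.right _ (by omega)
  · rename_i h
    exact Prod.Lex.left _ _ h.1
  · rename_i h
    exact Prod.Lex.left _ _ h.2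

/-- The generating series `Σ_g t^g (Σ_{i ∈ S} v_i)^2 F_g(v_S)`. -/
def ptS (v : ι → A) (S : Finset ι) : PowerSeries A := PowerSeries.mk (ptH v S)

@[simp] lemma coeff_ptS (v : ι → A) (S : Finset ι) (g : ℕ) :
    PowerSeries.coeff g (ptS v S) = ptH v S g := PowerSeries.coeff_mk _ _

@[simp] lemma ptH_empty (v : ι → A) (g : ℕ) : ptH v ∅ g = 0 := by
  rw [ptH]
  simp

@[simp] lemma ptS_empty (v : ι → A) : ptS v ∅ = 0 := by
  ext g
  simp

lemma ptH_singleton_zero (v : ι → A) (i : ι) : ptH v {i} 0 = 1 := by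
  rw [ptH]
  simp

lemma ptH_of_card_eq_one (v : ι → A) {S : Finset ι} (hS : S.card = 1) : ptH v S 0 = 1 := by
  obtain ⟨i, rfl⟩ := Finset.card_eq_one.1 hS
  exact ptH_singleton_zero v i

lemma ptH_rec (v : ι → A) (S : Finset ι) (g : ℕ) :
    (12 * (2 * g + S.card - 1) : A) * ptH v S g =
      (if 0 < g then (∑ i ∈ S, v i) ^ 3 * ptH v S (g - 1) else 0) +
      6 * (∑ i ∈ S, v i) * PowerSeries.coeff g (conv (ptS v) (ptS v) S) := by
  have hsum : ∑ I ∈ S.powerset, ∑ p ∈ antidiagonal g, (if I.card < S.card ∧ (S \ I).card < S.card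
        then ptH v I p.1 * ptH v (S \ I) p.2 else 0) =
      PowerSeries.coeff g (conv (ptS v) (ptS v) S) := by
    simp only [conv, map_sum, PowerSeries.coeff_mul, coeff_ptS]
    refine Finset.sum_congr rfl fun I hI => Finset.sum_congr rfl fun p _ => ?_
    rw [mem_powerset] at hI
    split_ifs with h
    · rfl
    · rcases eq_or_ne I S with rfl | hne
      · simp
      · rcases I.eq_empty_or_nonempty with rfl | hI'
        · simp
        · exact absurd ⟨card_lt_card (hI.ssubset_of_ne hne),
            card_lt_card (sdiff_ssubset hI hI')⟩ h
  rcases eq_or_ne S.card 0 with h0 | h0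
  · rw [card_eq_zero] at h0
    subst h0
    simp
  by_cases h1 : S.card = 1 ∧ g = 0
  · obtain ⟨h1, rfl⟩ := h1
    rw [← hsum, h1]
    have : ∑ I ∈ S.powerset, ∑ p ∈ antidiagonal 0, (if I.card < 1 ∧ (S \ I).card < 1
        then ptH v I p.1 * ptH v (S \ I) p.2 else 0) = 0 := by
      refine Finset.sum_eq_zero fun I hI => Finset.sum_eq_zero fun p _ => if_neg fun h => ?_
      have := Finset.card_sdiff_add_card_eq_card (mem_powerset.1 hI)
      omega
    rw [this]
    simp
  · have hne : (12 * (2 * g + S.card - 1) : ℚ) ≠ 0 := by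
      have : (2 * g + S.card : ℚ) ≠ 1 := by
        norm_cast
        omega
      simpa [sub_eq_zero] using this
    have hA : (12 * (2 * g + S.card - 1) : A) = algebraMap ℚ A (12 * (2 * g + S.card - 1)) := by
      rw [map_mul, map_sub, map_add, map_mul, map_ofNat, map_ofNat, map_natCast, map_natCast,
        map_one]
    conv_lhs => rw [ptH]
    rw [if_neg h0, if_neg h1, hsum, hA, ← mul_assoc, ← map_mul, mul_inv_cancel₀ hne, map_one,
      one_mul]

/-- The differential equation of the generating series of the `n`-point functions. -/
lemma eul_ptS (v : ι → A) (S : Finset ι) :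
    12 * (eul (ptS v) S - ptS v S) =
      PowerSeries.X * (PowerSeries.C (∑ i ∈ S, v i) ^ 3 * ptS v S) +
        6 * PowerSeries.C (∑ i ∈ S, v i) * conv (ptS v) (ptS v) S := by
  have h12 : (12 : PowerSeries A) = PowerSeries.C 12 := (map_ofNat _ 12).symm
  have h6 : (6 : PowerSeries A) = PowerSeries.C 6 := (map_ofNat _ 6).symm
  ext g
  have := ptH_rec v S g
  rw [h12, h6, ← map_pow, ← map_mul, map_add, PowerSeries.coeff_C_mul, PowerSeries.coeff_C_mul,
    map_sub, coeff_eul, coeff_ptS]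
  rcases g with _ | g
  · rw [if_neg (lt_irrefl 0)] at this
    rw [PowerSeries.coeff_zero_X_mul, ← this]
    push_cast
    ring
  · rw [if_pos g.succ_pos] at this
    rw [PowerSeries.coeff_succ_X_mul, PowerSeries.coeff_C_mul, coeff_ptS]
    rw [Nat.add_sub_cancel] at this
    rw [← this]
    push_cast
    ring

lemma algebraMap_mul_cancel {q : ℚ} (hq : q ≠ 0) {a b : A}
    (h : algebraMap ℚ A q * a = algebraMap ℚ A q * b) : a = b := by
  have := congrArg (algebraMap ℚ A q⁻¹ * ·) h
  simpa only [← mul_assoc, ← map_mul, inv_mul_cancel₀ hq, map_one, one_mul] using this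

lemma natCast_mul_cancel {n : ℕ} (hn : n ≠ 0) {a b : A} (h : (n : A) * a = n * b) : a = b :=
  algebraMap_mul_cancel (q := n) (by exact_mod_cast hn) (by simpa using h)

lemma conv_self_congr {B : Type*} [CommRing B] {f f' : Finset ι → B} {S : Finset ι} (h0 : f ∅ = 0)
    (h0' : f' ∅ = 0) (h : ∀ I, I ⊂ S → f I = f' I) : conv f f S = conv f' f' S := by
  refine Finset.sum_congr rfl fun I hI => ?_
  rw [mem_powerset] at hI
  rcases eq_or_ne I S with rfl | hne
  · simp [h0, h0']
  · rcases I.eq_empty_or_nonempty with rfl | hI'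
    · simp [h0, h0']
    · rw [h I (hI.ssubset_of_ne hne), h _ (sdiff_ssubset hI hI')]

/-- Naturality of the `n`-point functions under ring homomorphisms and relabelling. -/
lemma ptH_map (φ : A →+* A') (f : ι ↪ ι') (v : ι → A) (v' : ι' → A') (S : Finset ι)
    (hv : ∀ i ∈ S, v' (f i) = φ (v i)) (g : ℕ) : ptH v' (S.map f) g = φ (ptH v S g) := by
  by_cases h0 : S.card = 0
  · rw [card_eq_zero] at h0
    simp [h0]
  by_cases h1 : S.card = 1 ∧ g = 0
  · obtain ⟨h1, rfl⟩ := h1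
    rw [ptH_of_card_eq_one v h1, ptH_of_card_eq_one v' (by rwa [card_map]), map_one]
  have hsum : ∑ i ∈ S.map f, v' i = φ (∑ i ∈ S, v i) := by
    rw [Finset.sum_map, map_sum]
    exact Finset.sum_congr rfl hv
  have hc : conv (ptS v') (ptS v') (S.map f) = PowerSeries.map φ (conv (ptS v) (ptS v) S) := by
    rw [conv_map, map_conv]
    refine conv_self_congr (by simp) (by simp) fun I hI => ?_
    ext g
    have := card_lt_card hI
    simpa using ptH_map φ f v v' I (fun i hi => hv i (hI.subset hi)) g
  have h := ptH_rec v' (S.map f) g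
  have h' := congrArg φ (ptH_rec v S g)
  refine natCast_mul_cancel (n := 12 * (2 * g + S.card - 1)) (by omega) ?_
  rw [Nat.cast_mul, Nat.cast_sub (by omega)]
  push_cast
  rw [hsum, hc, card_map, PowerSeries.coeff_map] at h
  simp only [map_mul, map_add, map_sub, map_ofNat, map_one, map_natCast] at h'
  rw [h, h']
  congr 1
  split_ifs with hg
  · rw [map_mul, map_pow, ptH_map φ f v v' S hv (g - 1)]
  · rw [map_zero]
termination_by (S.card, g)
decreasing_by
  · exact Prod.Lex.left _ _ this
  · exact Prod.Lex.right _ (by omega)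

end PointFunction

section PointFunctionProperties

variable {ι A : Type*} [DecidableEq ι] [CommRing A] [Algebra ℚ A]

lemma algebraMap_mul_dvd {q : ℚ} (hq : q ≠ 0) {a b : A} (h : a ∣ algebraMap ℚ A q * b) :
    a ∣ b := by
  have := h.mul_left (algebraMap ℚ A q⁻¹)
  simpa only [← mul_assoc, ← map_mul, inv_mul_cancel₀ hq, map_one, one_mul] using this

lemma natCast_mul_dvd {n : ℕ} (hn : n ≠ 0) {a b : A} (h : a ∣ (n : A) * b) : a ∣ b :=
  algebraMap_mul_dvd (q := n) (by exact_mod_cast hn) (by simpa using h)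

/-- The sum over subsets entering the recursion is divisible by the sum of all variables. -/
lemma sum_dvd_coeff_conv_ptS (v : ι → A) (S : Finset ι) {g : ℕ} (hg : 2 < 2 * g + S.card) :
    ∑ i ∈ S, v i ∣ PowerSeries.coeff g (conv (ptS v) (ptS v) S) := by
  set w : Finset ι → PowerSeries A := fun I => ∑ i ∈ I, PowerSeries.C (v i) with hw
  set H := ptS v with hH
  set E := conv H H with hE
  have heq : ∀ I, 12 * (eul H I - H I) =
      PowerSeries.X * (w I ^ 3 * H I) + 6 * w I * E I := fun I => by
    simpa only [hw, map_sum] using eul_ptS v I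
  have heul : eul E S = 2 * conv H (eul H) S := by
    rw [hE, eul_conv, conv_comm (eul H), Pi.add_apply]
    ring
  have hT : w S * conv H E S = 3 * conv (fun I => w I * H I) E S ∧
      conv H (fun I => w I * E I) S = 2 * conv (fun I => w I * H I) E S := by
    have h2 : conv H (fun I => w I * E I) S = 2 * conv (fun I => w I * H I) E S := by
      have : (fun I => w I * E I) = fun I => 2 * conv (fun I => w I * H I) H I := by
        funext I
        simp only [hE, hw]
        rw [sum_mul_conv, conv_comm H]
        ring
      rw [this, conv_const_mul_right, ← conv_assoc, conv_comm H, conv_assoc]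
    refine ⟨?_, h2⟩
    simp only [hw] at h2 ⊢
    rw [sum_mul_conv, h2]
    ring
  have hcube : w S ∣ 2 * conv H (fun I => w I ^ 3 * H I) S := by
    have h1 : 2 * conv H (fun I => w I ^ 3 * H I) S =
        ∑ I ∈ S.powerset, (w I ^ 3 + w (S \ I) ^ 3) * (H I * H (S \ I)) := by
      rw [two_mul]
      nth_rw 1 [conv_comm]
      simp only [conv, ← Finset.sum_add_distrib]
      exact Finset.sum_congr rfl fun I _ => by ring
    rw [h1]
    refine Finset.dvd_sum fun I hI => Dvd.dvd.mul_right ?_ _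
    have : w S = w I + w (S \ I) := by
      rw [add_comm]
      exact (Finset.sum_sdiff (mem_powerset.1 hI)).symm
    rw [this]
    exact ⟨w I ^ 2 - w I * w (S \ I) + w (S \ I) ^ 2, by ring⟩
  have hmain : 36 * (eul E S - 2 * E S) =
      3 * PowerSeries.X * (2 * conv H (fun I => w I ^ 3 * H I) S) + 24 * (w S * conv H E S) := by
    have h3 : 12 * conv H (eul H) S = 12 * E S +
        (PowerSeries.X * conv H (fun I => w I ^ 3 * H I) S +
          6 * conv H (fun I => w I * E I) S) := by
      have : (fun I => 12 * eul H I) = (fun I => 12 * H I) +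
          ((fun I => PowerSeries.X * (w I ^ 3 * H I)) + fun I => 6 * (w I * E I)) := by
        funext I
        simp only [Pi.add_apply]
        linear_combination heq I
      have h4 := congrFun (congrArg (conv H) this) S
      rw [conv_add_right, conv_add_right] at h4
      simpa only [Pi.add_apply, conv_const_mul_right, ← hE] using h4
    rw [heul, hT.1]
    rw [hT.2] at h3
    linear_combination 6 * h3
  have hdvd : w S ∣ 36 * (eul E S - 2 * E S) := by
    rw [hmain]
    exact dvd_add (hcube.mul_left _) ((dvd_mul_right _ _).mul_left _)
  have hwS : w S = PowerSeries.C (∑ i ∈ S, v i) := (map_sum _ _ _).symm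
  obtain ⟨q, hq⟩ := hdvd
  rw [hwS] at hq
  have hcoef := congrArg (PowerSeries.coeff g) hq
  have h36 : (36 : PowerSeries A) = PowerSeries.C 36 := (map_ofNat _ 36).symm
  have h2 : (2 : PowerSeries A) = PowerSeries.C 2 := (map_ofNat _ 2).symm
  rw [h36, h2, PowerSeries.coeff_C_mul, PowerSeries.coeff_C_mul, map_sub, coeff_eul,
    PowerSeries.coeff_C_mul] at hcoef
  refine natCast_mul_dvd (n := 36 * (2 * g + S.card - 2)) (by omega)
    ⟨PowerSeries.coeff g q, ?_⟩
  rw [← hcoef, Nat.cast_mul, Nat.cast_sub hg.le]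
  push_cast
  ring

/-- In the stable range the `n`-point function is a polynomial. -/
lemma sum_sq_dvd_ptH (v : ι → A) (S : Finset ι) {g : ℕ} (hg : 2 < 2 * g + S.card) :
    (∑ i ∈ S, v i) ^ 2 ∣ ptH v S g := by
  refine natCast_mul_dvd (n := 12 * (2 * g + S.card - 1)) (by omega) ?_
  have := ptH_rec v S g
  rw [Nat.cast_mul, Nat.cast_sub (by omega)]
  push_cast
  rw [this]
  refine dvd_add ?_ ?_
  · split_ifs
    · exact (pow_dvd_pow _ (by norm_num)).mul_right _
    · exact dvd_zero _
  · obtain ⟨q, hq⟩ := sum_dvd_coeff_conv_ptS v S hg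
    exact ⟨6 * q, by rw [hq]; ring⟩

/-- The differential equation, singling out one variable. -/
lemma eul_ptS_insert (v : ι → A) {S : Finset ι} {i : ι} (hi : i ∉ S) :
    12 * eul (fun I => ptS v (insert i I)) S =
      PowerSeries.X * (PowerSeries.C (v i + ∑ j ∈ S, v j) ^ 3 * ptS v (insert i S)) +
        12 * PowerSeries.C (v i + ∑ j ∈ S, v j) *
          conv (fun I => ptS v (insert i I)) (ptS v) S := by
  have h := eul_ptS v (insert i S)
  rw [conv_insert _ _ hi, conv_comm (ptS v), Finset.sum_insert hi, eul, card_insert_of_notMem hi] at h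
  rw [eul]
  push_cast at h
  linear_combination h

/-- A family of power series satisfying a linear differential equation without constant term
vanishes. -/
lemma eq_zero_of_eul_eq {f : PowerSeries A} {a : A} {n : ℕ} (hn : n ≠ 0)
    (h : 12 * (2 * theta f + (n : PowerSeries A) * f) = PowerSeries.X * (PowerSeries.C a * f)) : f = 0 := by
  have h12 : (12 : PowerSeries A) = PowerSeries.C 12 := (map_ofNat _ 12).symm
  have h2 : (2 : PowerSeries A) = PowerSeries.C 2 := (map_ofNat _ 2).symm
  have hnn : (n : PowerSeries A) = PowerSeries.C (n : A) := (map_natCast _ _).symm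
  rw [h12, h2, hnn] at h
  ext g
  rw [map_zero]
  induction g with
  | zero =>
    have := congrArg (PowerSeries.coeff 0) h
    rw [PowerSeries.coeff_C_mul, PowerSeries.coeff_zero_X_mul, map_add, PowerSeries.coeff_C_mul,
      PowerSeries.coeff_C_mul, coeff_theta] at this
    refine natCast_mul_cancel (n := 12 * n) (by omega) ?_
    push_cast at this ⊢
    linear_combination this
  | succ g ih =>
    have := congrArg (PowerSeries.coeff (g + 1)) h
    rw [PowerSeries.coeff_C_mul, PowerSeries.coeff_succ_X_mul, PowerSeries.coeff_C_mul, ih, map_add,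
      PowerSeries.coeff_C_mul, PowerSeries.coeff_C_mul, coeff_theta] at this
    refine natCast_mul_cancel (n := 12 * (2 * (g + 1) + n)) (by omega) ?_
    push_cast at this ⊢
    linear_combination this

lemma ptS_singleton_of_sq_eq_zero (v : ι → A) {i : ι} (hε : v i ^ 2 = 0) : ptS v {i} = 1 := by
  have h := eul_ptS_insert v (S := ∅) (i := i) (by simp)
  have h3 : v i ^ 3 = 0 := by rw [pow_succ, hε, zero_mul]
  ext g
  rcases g with _ | g
  · simp [ptH_singleton_zero]
  · rw [coeff_ptS, PowerSeries.coeff_one, if_neg g.succ_ne_zero]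
    have := ptH_rec v {i} (g + 1)
    simp only [sum_singleton, h3, conv] at this
    have hz : ∑ I ∈ powerset {i}, ptS v I * ptS v ({i} \ I) = 0 := by
      refine Finset.sum_eq_zero fun I hI => ?_
      rcases Finset.subset_singleton_iff.1 (mem_powerset.1 hI) with rfl | rfl <;> simp
    rw [hz] at this
    refine natCast_mul_cancel (n := 12 * (2 * (g + 1))) (by omega) ?_
    simp at this
    push_cast
    linear_combination this

/-- The string and dilaton equations: the expansion of the `n`-point function to first order in
one of the variables. -/
lemma ptS_insert_of_sq_eq_zero (v : ι → A) {i : ι} (hε : v i ^ 2 = 0) (S : Finset ι)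
    (hi : i ∉ S) (hS : S.Nonempty) :
    ptS v (insert i S) =
      PowerSeries.C (∑ j ∈ S, v j) * ptS v S + PowerSeries.C (v i) * eul (ptS v) S := by
  induction S using Finset.strongInduction with
  | H S ih =>
  set ε := PowerSeries.C (v i) with hεdef
  have hε2 : ε ^ 2 = 0 := by rw [hεdef, ← map_pow, hε, map_zero]
  set x : PowerSeries A := PowerSeries.C (∑ j ∈ S, v j) with hx
  set H := ptS v with hH
  set E := conv H H with hE
  set J₀ : Finset ι → PowerSeries A :=
    fun I => PowerSeries.C (∑ j ∈ I, v j) * H I + ε * eul H I with hJ₀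
  have hJ₀empty : J₀ ∅ = 0 := by simp [hJ₀, eul, hH, theta]
  have hconv : conv (fun I => H (insert i I)) H S = H S + conv J₀ H S := by
    have h1 : ∅ ∈ S.powerset := by simp
    rw [conv, conv, ← Finset.add_sum_erase _ _ h1, ← Finset.add_sum_erase _ _ h1, hJ₀empty]
    have hsing : H (insert i ∅) = 1 := ptS_singleton_of_sq_eq_zero v hε
    rw [hsing, sdiff_empty, one_mul, zero_mul, zero_add]
    congr 1
    refine Finset.sum_congr rfl fun I hI => ?_
    rw [mem_erase, mem_powerset] at hI
    rcases eq_or_ne I S with rfl | hne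
    · simp [hH]
    · rw [ih I (hI.2.ssubset_of_ne hne) (fun h => hi (hI.2 h)) (nonempty_iff_ne_empty.2 hI.1)]
  have hJ₀conv : 2 * conv J₀ H S = x * E S + ε * eul E S := by
    have : J₀ = (fun I => (∑ j ∈ I, PowerSeries.C (v j)) * H I) + fun I => ε * eul H I := by
      funext I
      simp [hJ₀]
    rw [this, conv_add_left, conv_const_mul_left, hE, eul_conv, conv_comm H (eul H), hx, map_sum,
      sum_mul_conv, conv_comm H]
    simp only [Pi.add_apply]
    ring
  have hJ := eul_ptS_insert v hi
  rw [hconv, map_add] at hJ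
  have heq := eul_ptS v S
  have hee : 12 * (eul (eul H) S - eul H S) = PowerSeries.X * (x ^ 3 * eul H S) +
      2 * PowerSeries.X * (x ^ 3 * H S) + 6 * x * eul E S := by
    have h1 := congrArg theta heq
    rw [← map_pow] at h1
    simp only [eul, theta_mul, theta_add, theta_sub, theta_C, theta_X, theta_natCast,
      theta_ofNat] at h1
    simp only [eul, theta_mul, theta_add, theta_natCast, theta_ofNat] at heq ⊢
    rw [map_pow, ← hx] at h1
    linear_combination 2 * h1 + (S.card : PowerSeries A) * heq
  have hδ : H (insert i S) - J₀ S = 0 := by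
    refine eq_zero_of_eul_eq (a := (v i + ∑ j ∈ S, v j) ^ 3) (n := S.card)
      (card_ne_zero.2 hS) ?_
    have hθ : theta (J₀ S) = x * theta (H S) + ε * theta (eul H S) := by
      rw [hJ₀, theta_add, hεdef, theta_C_mul, theta_C_mul]
    have hJ' : 12 * (2 * theta (H (insert i S)) + (S.card : PowerSeries A) * H (insert i S)) =
      PowerSeries.X * ((ε + x) ^ 3 * H (insert i S)) +
        12 * (ε + x) * (H S + conv J₀ H S) := hJ
    have heq' : 12 * (eul H S - H S) = PowerSeries.X * (x ^ 3 * H S) + 6 * x * E S := heq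
    have hee' : 12 * ((2 * theta (eul H S) + (S.card : PowerSeries A) * eul H S) - eul H S) =
      PowerSeries.X * (x ^ 3 * eul H S) +
      2 * PowerSeries.X * (x ^ 3 * H S) + 6 * x * eul E S := hee
    have heul : eul H S = 2 * theta (H S) + (S.card : PowerSeries A) * H S := rfl
    have hJS : J₀ S = x * H S + ε * eul H S := rfl
    rw [theta_sub, hθ, hJS, map_pow, map_add, ← hx, ← hεdef]
    linear_combination hJ' + 6 * (ε + x) * hJ₀conv - (x + ε) * heq' - ε * hee' +
      12 * x * heul + (PowerSeries.X * (3 * x ^ 2 * H S + 3 * x ^ 2 * eul H S +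
        ε * (x * H S + 3 * x * eul H S) + ε ^ 2 * eul H S) + 6 * eul E S) * hε2
  exact sub_eq_zero.1 hδ

end PointFunctionProperties

section TwoPoint

variable {ι B : Type*} [DecidableEq ι] [CommRing B] [Algebra ℚ B]

/-- The `n`-point functions with one additional variable `s`. -/
def optS (s : B) (v : ι → B) (I : Finset ι) : PowerSeries B :=
  ptS (fun o : Option ι => o.elim s v) (insert none (I.map Function.Embedding.some))

lemma sum_map_some (s : B) (v : ι → B) (S : Finset ι) :
    ∑ j ∈ S.map Function.Embedding.some, (fun o : Option ι => o.elim s v) j = ∑ j ∈ S, v j := by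
  simp

lemma ptS_map_some (s : B) (v : ι → B) (S : Finset ι) :
    ptS (fun o : Option ι => o.elim s v) (S.map Function.Embedding.some) = ptS v S := by
  ext g
  rw [coeff_ptS, coeff_ptS, ptH_map (RingHom.id B) Function.Embedding.some v _ S (by simp)]
  rfl

lemma none_notMem_map_some (S : Finset ι) : none ∉ S.map Function.Embedding.some := by simp

lemma eul_optS (s : B) (v : ι → B) (S : Finset ι) :
    12 * eul (optS s v) S =
      PowerSeries.X * (PowerSeries.C (s + ∑ j ∈ S, v j) ^ 3 * optS s v S) +
        12 * PowerSeries.C (s + ∑ j ∈ S, v j) * conv (optS s v) (ptS v) S := by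
  have h := eul_ptS_insert (fun o : Option ι => o.elim s v) (none_notMem_map_some S)
  rw [sum_map_some, eul, card_map, conv_map] at h
  simp only [ptS_map_some] at h
  exact h

/-- The product of the `n`-point function with an extra variable and a power of the sum of the
variables. -/
def powOptS (s : B) (v : ι → B) (α : ℕ) (I : Finset ι) : PowerSeries B :=
  PowerSeries.C (s + ∑ i ∈ I, v i) ^ α * optS s v I

/-- The product of the `n`-point function and a power of the sum of the variables. -/
def powS (v : ι → B) (k : ℕ) (I : Finset ι) : PowerSeries B :=
  PowerSeries.C (∑ i ∈ I, v i) ^ k * ptS v I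

lemma powOptS_conv (s : B) (v : ι → B) (α : ℕ) (S : Finset ι) :
    PowerSeries.C (s + ∑ i ∈ S, v i) ^ α * conv (optS s v) (ptS v) S =
      ∑ k ∈ range (α + 1),
        (α.choose k : PowerSeries B) * conv (powOptS s v (α - k)) (powS v k) S := by
  simp only [conv, Finset.mul_sum]
  rw [Finset.sum_comm]
  refine Finset.sum_congr rfl fun I hI => ?_
  have hs : s + ∑ i ∈ S, v i = ∑ i ∈ S \ I, v i + (s + ∑ i ∈ I, v i) := by
    rw [← Finset.sum_sdiff (mem_powerset.1 hI)]
    ring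
  rw [hs, map_add, add_pow, Finset.sum_mul]
  refine Finset.sum_congr rfl fun k _ => ?_
  simp only [powOptS, powS]
  ring

lemma eul_powOptS (s : B) (v : ι → B) (α : ℕ) (S : Finset ι) :
    12 * eul (powOptS s v α) S = PowerSeries.X * powOptS s v (α + 3) S +
      12 * ∑ k ∈ range (α + 2),
        ((α + 1).choose k : PowerSeries B) * conv (powOptS s v (α + 1 - k)) (powS v k) S := by
  have h1 : powOptS s v α = fun I => PowerSeries.C ((s + ∑ i ∈ I, v i) ^ α) * optS s v I := by
    funext I
    simp [powOptS]
  rw [← powOptS_conv, h1, eul_C_mul]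
  simp only [powOptS, map_pow]
  linear_combination PowerSeries.C (s + ∑ i ∈ S, v i) ^ α * eul_optS s v S

/-- The two-point combination of `n`-point functions. -/
def twoS (s : B) (v : ι → B) (α β : ℕ) : Finset ι → PowerSeries B :=
  conv (powOptS s v α) (powOptS (-s) v β)

lemma sum_mul_twoS (s : B) (v : ι → B) (α β : ℕ) (S : Finset ι) :
    PowerSeries.C (∑ i ∈ S, v i) * twoS s v α β S =
      twoS s v (α + 1) β S + twoS s v α (β + 1) S := by
  simp only [twoS, conv, Finset.mul_sum, ← Finset.sum_add_distrib]
  refine Finset.sum_congr rfl fun I hI => ?_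
  have hs : ∑ i ∈ S, v i = (s + ∑ i ∈ I, v i) + (-s + ∑ i ∈ S \ I, v i) := by
    rw [← Finset.sum_sdiff (mem_powerset.1 hI)]
    ring
  rw [hs, map_add]
  simp only [powOptS]
  ring

lemma conv_natCast_sum_left {κ : Type*} (s : Finset κ) (a : κ → PowerSeries B)
    (f : κ → Finset ι → PowerSeries B) (g : Finset ι → PowerSeries B) (S : Finset ι) :
    conv (fun S => ∑ k ∈ s, a k * f k S) g S = ∑ k ∈ s, a k * conv (f k) g S := by
  simp only [conv, Finset.sum_mul, Finset.mul_sum, mul_assoc]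
  exact Finset.sum_comm

lemma conv_eul_powOptS (s : B) (v : ι → B) (α : ℕ) (g : Finset ι → PowerSeries B)
    (S : Finset ι) :
    12 * conv (eul (powOptS s v α)) g S =
      PowerSeries.X * conv (powOptS s v (α + 3)) g S +
      12 * ∑ k ∈ range (α + 2), ((α + 1).choose k : PowerSeries B) *
        conv (conv (powOptS s v (α + 1 - k)) g) (powS v k) S := by
  have h1 : (fun I => 12 * eul (powOptS s v α) I) =
      (fun I => PowerSeries.X * powOptS s v (α + 3) I) + fun I => 12 *
        (fun S => ∑ k ∈ range (α + 2), ((α + 1).choose k : PowerSeries B) *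
          conv (powOptS s v (α + 1 - k)) (powS v k) S) I := by
    funext I
    exact eul_powOptS s v α I
  have h2 := congrFun (congrArg (fun f => conv f g) h1) S
  simp only [conv_add_left, conv_const_mul_left, Pi.add_apply] at h2
  rw [h2, conv_natCast_sum_left]
  have h3 : ∀ k, conv (conv (powOptS s v (α + 1 - k)) g) (powS v k) =
      conv (conv (powOptS s v (α + 1 - k)) (powS v k)) g := fun k => by
    rw [conv_assoc, conv_comm g, ← conv_assoc]
  simp only [h3]

lemma eul_twoS (s : B) (v : ι → B) (α β : ℕ) (S : Finset ι) :
    12 * eul (twoS s v α β) S =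
      PowerSeries.X * (PowerSeries.C (∑ i ∈ S, v i) *
        (twoS s v (α + 2) β S - twoS s v (α + 1) (β + 1) S + twoS s v α (β + 2) S)) +
      12 * conv (fun I => PowerSeries.C (∑ i ∈ I, v i) * twoS s v α β I) (ptS v) S +
      12 * ∑ k ∈ range (α + 1),
        ((α + 1).choose (k + 1) : PowerSeries B) *
          conv (twoS s v (α - k) β) (powS v (k + 1)) S +
      12 * ∑ k ∈ range (β + 1),
        ((β + 1).choose (k + 1) : PowerSeries B) *
          conv (twoS s v α (β - k)) (powS v (k + 1)) S := by
  have key := fun s α g => conv_eul_powOptS s v α g S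
  have hz : powS v 0 = ptS v := by
    funext I
    simp [powS]
  have hL : (fun I => PowerSeries.C (∑ i ∈ I, v i) * twoS s v α β I) =
      twoS s v (α + 1) β + twoS s v α (β + 1) := by
    funext I
    exact sum_mul_twoS s v α β I
  have h1 := key s α (powOptS (-s) v β)
  have h2 := key (-s) β (powOptS s v α)
  rw [hL, conv_add_left]
  rw [Finset.sum_range_succ'] at h1 h2
  simp only [hz, conv_comm (powOptS (-s) v _), Nat.add_sub_add_right, Nat.choose_zero_right,
    Nat.cast_one, one_mul, Nat.sub_zero] at h1 h2
  have h3 := sum_mul_twoS s v (α + 2) β S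
  have h4 := sum_mul_twoS s v (α + 1) (β + 1) S
  have h5 := sum_mul_twoS s v α (β + 2) S
  simp only [twoS, eul_conv, Pi.add_apply] at h3 h4 h5 ⊢
  rw [conv_comm (powOptS s v α) (eul _)]
  linear_combination h1 + h2 - PowerSeries.X * h3 + PowerSeries.X * h4 - PowerSeries.X * h5

end TwoPoint

section CoefficientExtraction

variable {ι A A' : Type*} [DecidableEq ι] [CommRing A] [Algebra ℚ A] [CommRing A'] [Algebra ℚ A']

/-- Extraction of the coefficient of `y ^ d`, for power series with coefficients polynomial
in `y`. -/
def yc (d : ℕ) : PowerSeries (Polynomial A) →+ PowerSeries A where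
  toFun f := PowerSeries.mk fun g => (PowerSeries.coeff g f).coeff d
  map_zero' := by ext; simp
  map_add' f h := by ext; simp

@[simp] lemma coeff_yc (d g : ℕ) (f : PowerSeries (Polynomial A)) :
    PowerSeries.coeff g (yc d f) = (PowerSeries.coeff g f).coeff d := by
  simp [yc]

lemma yc_sum {κ : Type*} (d : ℕ) (s : Finset κ) (f : κ → PowerSeries (Polynomial A)) :
    yc d (∑ k ∈ s, f k) = ∑ k ∈ s, yc d (f k) := map_sum _ _ _

lemma yc_map_mul (d : ℕ) (h : PowerSeries A) (f : PowerSeries (Polynomial A)) :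
    yc d (PowerSeries.map Polynomial.C h * f) = h * yc d f := by
  ext g
  simp [PowerSeries.coeff_mul, Polynomial.finsetSum_coeff]

lemma yc_X_mul (d : ℕ) (f : PowerSeries (Polynomial A)) :
    yc d (PowerSeries.X * f) = PowerSeries.X * yc d f := by
  rw [← yc_map_mul, PowerSeries.map_X]

lemma yc_natCast_mul (d n : ℕ) (f : PowerSeries (Polynomial A)) :
    yc d ((n : PowerSeries (Polynomial A)) * f) = (n : PowerSeries A) * yc d f := by
  rw [← yc_map_mul, map_natCast]

lemma yc_ofNat_mul (d n : ℕ) [n.AtLeastTwo] (f : PowerSeries (Polynomial A)) :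
    yc d ((ofNat(n) : PowerSeries (Polynomial A)) * f) = ofNat(n) * yc d f :=
  yc_natCast_mul d n f

lemma yc_theta (d : ℕ) (f : PowerSeries (Polynomial A)) : yc d (theta f) = theta (yc d f) := by
  ext g
  simp only [coeff_yc, coeff_theta]
  rw [← Polynomial.C_eq_natCast, Polynomial.coeff_C_mul]

lemma yc_C_sum_mul (d : ℕ) (v : ι → A) (S : Finset ι) (f : PowerSeries (Polynomial A)) :
    yc d (PowerSeries.C (∑ i ∈ S, Polynomial.C (v i)) * f) =
      PowerSeries.C (∑ i ∈ S, v i) * yc d f := by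
  rw [← yc_map_mul, PowerSeries.map_C, map_sum Polynomial.C]

lemma ptS_map (φ : A →+* A') (v : ι → A) (v' : ι → A') (S : Finset ι)
    (hv : ∀ i ∈ S, v' i = φ (v i)) : ptS v' S = PowerSeries.map φ (ptS v S) := by
  ext g
  rw [PowerSeries.coeff_map, coeff_ptS, coeff_ptS,
    ← ptH_map φ (Function.Embedding.refl ι) v v' S hv, map_refl]

lemma powS_C (v : ι → A) (k : ℕ) (S : Finset ι) :
    powS (fun i => Polynomial.C (v i)) k S = PowerSeries.map Polynomial.C (powS v k S) := by
  rw [powS, powS, ptS_map Polynomial.C v _ S fun _ _ => rfl, map_mul, map_pow, PowerSeries.map_C,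
    map_sum Polynomial.C]

lemma yc_conv_powS (d : ℕ) (f : Finset ι → PowerSeries (Polynomial A)) (v : ι → A) (k : ℕ)
    (S : Finset ι) : yc d (conv f (powS (fun i => Polynomial.C (v i)) k) S) =
      conv (fun I => yc d (f I)) (powS v k) S := by
  simp only [conv, map_sum, powS_C]
  exact Finset.sum_congr rfl fun I _ => by rw [mul_comm, yc_map_mul, mul_comm]

lemma yc_eul (d : ℕ) (f : Finset ι → PowerSeries (Polynomial A)) (S : Finset ι) :
    yc d (eul f S) = eul (fun I => yc d (f I)) S := by
  rw [eul, eul, map_add, yc_ofNat_mul, yc_natCast_mul, yc_theta]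

/-- The coefficient of `y ^ d` in the two-point combination of `n`-point functions. -/
def twoC (v : ι → A) (α β d : ℕ) (S : Finset ι) : PowerSeries A :=
  yc d (twoS Polynomial.X (fun i => Polynomial.C (v i)) α β S)

lemma powS_zero {B : Type*} [CommRing B] [Algebra ℚ B] (v : ι → B) : powS v 0 = ptS v := by
  funext I
  simp [powS]

lemma sum_mul_twoC (v : ι → A) (α β d : ℕ) (S : Finset ι) :
    PowerSeries.C (∑ i ∈ S, v i) * twoC v α β d S =
      twoC v (α + 1) β d S + twoC v α (β + 1) d S := by
  have h := congrArg (yc d) (sum_mul_twoS Polynomial.X (fun i => Polynomial.C (v i)) α β S)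
  rwa [yc_C_sum_mul, map_add] at h

lemma eul_twoC (v : ι → A) (α β d : ℕ) (S : Finset ι) :
    12 * eul (twoC v α β d) S =
      PowerSeries.X * (PowerSeries.C (∑ i ∈ S, v i) *
        (twoC v (α + 2) β d S - twoC v (α + 1) (β + 1) d S + twoC v α (β + 2) d S)) +
      12 * conv (fun I => PowerSeries.C (∑ i ∈ I, v i) * twoC v α β d I) (powS v 0) S +
      12 * ∑ k ∈ range (α + 1),
        ((α + 1).choose (k + 1) : PowerSeries A) *
          conv (twoC v (α - k) β d) (powS v (k + 1)) S +
      12 * ∑ k ∈ range (β + 1),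
        ((β + 1).choose (k + 1) : PowerSeries A) *
          conv (twoC v α (β - k) d) (powS v (k + 1)) S := by
  have h := congrArg (yc d) (eul_twoS Polynomial.X (fun i => Polynomial.C (v i)) α β S)
  rw [← powS_zero] at h
  simp only [map_add, map_sub, yc_sum, yc_ofNat_mul, yc_natCast_mul, yc_X_mul, yc_C_sum_mul,
    yc_eul, yc_conv_powS] at h
  exact h

lemma coeff_conv_powS (f : Finset ι → PowerSeries A) (v : ι → A) (k g : ℕ) (S : Finset ι) :
    PowerSeries.coeff g (conv f (powS v k) S) =
      ∑ I ∈ S.powerset.erase S, ∑ p ∈ antidiagonal g, PowerSeries.coeff p.1 (f I) *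
        ((∑ i ∈ S \ I, v i) ^ k * ptH v (S \ I) p.2) := by
  have hc : ∀ M p, PowerSeries.coeff p (powS v k M) = (∑ i ∈ M, v i) ^ k * ptH v M p := by
    intro M p
    rw [powS, ← map_pow, PowerSeries.coeff_C_mul, coeff_ptS]
  rw [conv, map_sum, ← Finset.add_sum_erase _ _ (mem_powerset_self S)]
  simp only [Finset.sdiff_self, PowerSeries.coeff_mul, hc, ptH_empty, mul_zero, sum_const_zero, zero_add]

lemma twoS_empty {B : Type*} [CommRing B] [Algebra ℚ B] (s : B) (v : ι → B) (α β : ℕ) :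
    PowerSeries.coeff 0 (twoS s v α β ∅) = s ^ α * (-s) ^ β := by
  simp only [twoS, conv, powerset_empty, sum_singleton, sdiff_self, powOptS, sum_empty, add_zero,
    optS, map_empty, insert_empty_eq]
  simp [PowerSeries.coeff_mul, ptH_singleton_zero]

lemma coeff_conv_powS_eq_zero (f : Finset ι → PowerSeries A) (v : ι → A) (k g : ℕ)
    (S : Finset ι) (h : ∀ I ⊂ S, ∀ p ≤ g, PowerSeries.coeff p (f I) = 0) :
    PowerSeries.coeff g (conv f (powS v k) S) = 0 := by
  rw [coeff_conv_powS]
  refine Finset.sum_eq_zero fun I hI => Finset.sum_eq_zero fun p hp => ?_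
  rw [mem_erase, mem_powerset] at hI
  rw [h I (hI.2.ssubset_of_ne hI.1) p.1 (by have := HasAntidiagonal.mem_antidiagonal.1 hp; omega), zero_mul]

lemma coeff_eul_twoC (v : ι → A) (α β d g : ℕ) (S : Finset ι) :
    12 * (((2 * g + S.card : ℕ) : A) * PowerSeries.coeff g (twoC v α β d S)) =
      PowerSeries.coeff g (PowerSeries.X * (PowerSeries.C (∑ i ∈ S, v i) *
        (twoC v (α + 2) β d S - twoC v (α + 1) (β + 1) d S + twoC v α (β + 2) d S))) +
      12 * PowerSeries.coeff g
        (conv (fun I => PowerSeries.C (∑ i ∈ I, v i) * twoC v α β d I) (powS v 0) S) +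
      12 * ∑ k ∈ range (α + 1),
        ((α + 1).choose (k + 1) : A) *
          PowerSeries.coeff g (conv (twoC v (α - k) β d) (powS v (k + 1)) S) +
      12 * ∑ k ∈ range (β + 1),
        ((β + 1).choose (k + 1) : A) *
          PowerSeries.coeff g (conv (twoC v α (β - k) d) (powS v (k + 1)) S) := by
  have h12 : (12 : PowerSeries A) = PowerSeries.C 12 := (map_ofNat _ 12).symm
  have h := congrArg (PowerSeries.coeff g) (eul_twoC v α β d S)
  have hsum : ∀ (s : Finset ℕ) (f : ℕ → PowerSeries A),
    PowerSeries.coeff g (∑ k ∈ s, f k) = ∑ k ∈ s, PowerSeries.coeff g (f k) := fun s f => map_sum _ _ _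
  simp only [map_add, hsum, h12, PowerSeries.coeff_C_mul, coeff_eul] at h
  simp only [← map_natCast (PowerSeries.C (R := A)), PowerSeries.coeff_C_mul] at h
  exact h

/-- The degree bound in `y` of the two-point combination of `n`-point functions. -/
lemma coeff_twoC_eq_zero (v : ι → A) (S : Finset ι) : ∀ (g α β d : ℕ), 2 * g + α + β < d →
    PowerSeries.coeff g (twoC v α β d S) = 0 := by
  induction S using Finset.strongInduction with
  | H S ihS =>
  have key : ∀ g α β d, 2 * g + α + β < d →
      12 * (((2 * g + S.card : ℕ) : A) * PowerSeries.coeff g (twoC v α β d S)) =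
      PowerSeries.coeff g (PowerSeries.X * (PowerSeries.C (∑ i ∈ S, v i) *
        (twoC v (α + 2) β d S - twoC v (α + 1) (β + 1) d S + twoC v α (β + 2) d S))) := by
    intro g α β d hd
    rw [coeff_eul_twoC, coeff_conv_powS_eq_zero, Finset.sum_eq_zero (s := range (α + 1)),
      Finset.sum_eq_zero (s := range (β + 1))]
    · ring
    · intro k _
      rw [coeff_conv_powS_eq_zero, mul_zero]
      exact fun I hI p hp => ihS I hI _ _ _ _ (by omega)
    · intro k _
      rw [coeff_conv_powS_eq_zero, mul_zero]
      exact fun I hI p hp => ihS I hI _ _ _ _ (by omega)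
    · intro I hI p hp
      rw [PowerSeries.coeff_C_mul, ihS I hI _ _ _ _ (by omega), mul_zero]
  intro g
  induction g with
  | zero =>
    intro α β d hd
    rcases S.eq_empty_or_nonempty with rfl | hS
    · rw [twoC, coeff_yc, twoS_empty, neg_pow, mul_left_comm, ← pow_add]
      rw [← map_one Polynomial.C, ← map_neg, ← map_pow, Polynomial.coeff_C_mul,
        Polynomial.coeff_X_pow, if_neg (by omega), mul_zero]
    · have h := key 0 α β d hd
      rw [PowerSeries.coeff_zero_X_mul, Nat.mul_zero, Nat.zero_add] at h
      refine natCast_mul_cancel (n := 12 * S.card) (by have := card_ne_zero.2 hS; omega) ?_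
      rw [mul_zero, Nat.cast_mul, mul_assoc, Nat.cast_ofNat]
      exact h
  | succ g ih =>
    intro α β d hd
    have h := key (g + 1) α β d hd
    rw [PowerSeries.coeff_succ_X_mul, PowerSeries.coeff_C_mul, map_add, map_sub,
      ih _ _ _ (by omega), ih _ _ _ (by omega), ih _ _ _ (by omega), sub_zero, add_zero,
      mul_zero] at h
    refine natCast_mul_cancel (n := 12 * (2 * (g + 1) + S.card)) (by omega) ?_
    rw [mul_zero, Nat.cast_mul, mul_assoc, Nat.cast_ofNat]
    exact h

/-- The leading coefficient in `y` of the two-point combination of `n`-point functions. -/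
def leadC (v : ι → A) (α β g : ℕ) (S : Finset ι) : A :=
  PowerSeries.coeff g (twoC v α β (2 * g + α + β) S)

lemma leadC_succ (v : ι → A) (α β g : ℕ) (S : Finset ι) :
    leadC v α (β + 1) g S = - leadC v (α + 1) β g S := by
  have h := congrArg (PowerSeries.coeff g) (sum_mul_twoC v α β (2 * g + α + β + 1) S)
  rw [PowerSeries.coeff_C_mul, coeff_twoC_eq_zero v S _ _ _ _ (Nat.lt_succ_self _), mul_zero,
    map_add] at h
  have h1 : 2 * g + (α + 1) + β = 2 * g + α + β + 1 := by ring
  rw [leadC, leadC, h1]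
  exact (neg_eq_of_add_eq_zero_right h.symm).symm

lemma leadC_empty_zero (v : ι → A) (α β : ℕ) : leadC v α β 0 ∅ = (-1) ^ β := by
  rw [leadC, twoC, coeff_yc, twoS_empty, neg_pow, mul_left_comm, ← pow_add,
    ← map_one Polynomial.C, ← map_neg, ← map_pow, Polynomial.coeff_C_mul,
    Polynomial.coeff_X_pow, if_pos (by ring), mul_one]

lemma coeff_conv_powS_of_top (f : Finset ι → PowerSeries A) (v : ι → A) (k g : ℕ)
    (S : Finset ι) (h : ∀ I ⊂ S, ∀ p < g, PowerSeries.coeff p (f I) = 0) :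
    PowerSeries.coeff g (conv f (powS v k) S) =
      ∑ I ∈ S.powerset.erase S, PowerSeries.coeff g (f I) *
        ((∑ i ∈ S \ I, v i) ^ k * ptH v (S \ I) 0) := by
  rw [coeff_conv_powS]
  refine Finset.sum_congr rfl fun I hI => ?_
  rw [mem_erase, mem_powerset] at hI
  rw [Finset.sum_eq_single (g, 0)]
  · intro p hp hne
    have hp' := HasAntidiagonal.mem_antidiagonal.1 hp
    rw [h I (hI.2.ssubset_of_ne hI.1) p.1 ?_, zero_mul]
    by_contra hlt
    exact hne (Prod.ext (by simp; omega) (by simp; omega))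
  · simp [HasAntidiagonal.mem_antidiagonal]

/-- The recursion for the leading coefficients. -/
lemma leadC_rec (v : ι → A) (α β g : ℕ) (S : Finset ι) :
    12 * (((2 * g + S.card : ℕ) : A) * leadC v α β g S) =
      (if 0 < g then 3 * ((∑ i ∈ S, v i) * leadC v (α + 2) β (g - 1) S) else 0) +
      12 * ∑ I ∈ S.powerset.erase S, (∑ i ∈ I, v i + (α + β + 2) * ∑ i ∈ S \ I, v i) *
        leadC v α β g I * ptH v (S \ I) 0 := by
  rw [leadC, coeff_eul_twoC, Finset.sum_eq_single (s := range (α + 1)) 0,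
    Finset.sum_eq_single (s := range (β + 1)) 0]
  · have h0 : ∀ I ⊂ S, ∀ p < g, PowerSeries.coeff p (twoC v α β (2 * g + α + β) I) = 0 :=
      fun I hI p hp => coeff_twoC_eq_zero _ _ _ _ _ _ (by omega)
    rw [coeff_conv_powS_of_top, coeff_conv_powS_of_top, coeff_conv_powS_of_top]
    · simp only [add_assoc]
      congr 1
      · rcases g with _ | g
        · simp
        · have h1 := leadC_succ v (α + 1) β g S
          have h2 := leadC_succ v α (β + 1) g S
          have e1 : 2 * (g + 1) + (α + β) = 2 * g + (α + 2) + β := by ring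
          have e2 : 2 * g + (α + 2) + β = 2 * g + (α + 1) + (β + 1) := by ring
          have e3 : 2 * g + (α + 2) + β = 2 * g + α + (β + 2) := by ring
          rw [if_pos g.succ_pos, PowerSeries.coeff_succ_X_mul, PowerSeries.coeff_C_mul, map_add,
            map_sub, e1]
          nth_rw 2 [e2]
          nth_rw 2 [e3]
          change _ * (leadC v (α + 2) β g S - leadC v (α + 1) (β + 1) g S +
            leadC v α (β + 2) g S) = _
          rw [Nat.add_sub_cancel]
          linear_combination (∑ i ∈ S, v i) * (h2 - 2 * h1)
      · simp only [PowerSeries.coeff_C_mul, leadC, ← mul_add, ← add_assoc]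
        congr 1
        simp only [zero_add, Nat.choose_one_right, Nat.sub_zero, pow_zero, pow_one]
        rw [Finset.mul_sum, Finset.mul_sum, ← Finset.sum_add_distrib, ← Finset.sum_add_distrib]
        refine Finset.sum_congr rfl fun I _ => ?_
        push_cast
        ring
    · exact h0
    · exact h0
    · intro I hI p hp
      rw [PowerSeries.coeff_C_mul, h0 I hI p hp, mul_zero]
  · intro k hk hk0
    rw [coeff_conv_powS_eq_zero, mul_zero]
    intro I hI p hp
    rw [mem_range] at hk
    exact coeff_twoC_eq_zero _ _ _ _ _ _ (by omega)
  · simp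
  · intro k hk hk0
    rw [coeff_conv_powS_eq_zero, mul_zero]
    intro I hI p hp
    rw [mem_range] at hk
    exact coeff_twoC_eq_zero _ _ _ _ _ _ (by omega)
  · simp

end CoefficientExtraction

section LeadingCoefficient

variable {ι A A' : Type*} [DecidableEq ι] [CommRing A] [Algebra ℚ A] [CommRing A'] [Algebra ℚ A']

lemma optS_map (φ : A →+* A') (s : A) (s' : A') (v : ι → A) (v' : ι → A') (S : Finset ι)
    (hs : s' = φ s) (hv : ∀ i ∈ S, v' i = φ (v i)) :
    optS s' v' S = PowerSeries.map φ (optS s v S) := by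
  refine ptS_map φ _ _ _ fun o ho => ?_
  rcases o with _ | i
  · exact hs
  · exact hv i (by simpa using ho)

lemma powOptS_map (φ : A →+* A') (s : A) (s' : A') (v : ι → A) (v' : ι → A') (α : ℕ)
    (S : Finset ι) (hs : s' = φ s) (hv : ∀ i ∈ S, v' i = φ (v i)) :
    powOptS s' v' α S = PowerSeries.map φ (powOptS s v α S) := by
  rw [powOptS, powOptS, optS_map φ s s' v v' S hs hv, Finset.sum_congr rfl hv, hs, map_mul,
    map_pow, PowerSeries.map_C, map_add φ, map_sum φ]

lemma twoS_map (φ : A →+* A') (s : A) (s' : A') (v : ι → A) (v' : ι → A') (α β : ℕ)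
    (S : Finset ι) (hs : s' = φ s) (hv : ∀ i ∈ S, v' i = φ (v i)) :
    twoS s' v' α β S = PowerSeries.map φ (twoS s v α β S) := by
  rw [twoS, twoS, map_conv]
  refine Finset.sum_congr rfl fun I hI => ?_
  rw [powOptS_map φ s s' v v' α I hs fun i hi => hv i (mem_powerset.1 hI hi),
    powOptS_map φ (-s) (-s') v v' β (S \ I) (by rw [hs, map_neg])
      fun i hi => hv i (mem_sdiff.1 hi).1]

lemma leadC_map (φ : A →+* A') (v : ι → A) (v' : ι → A') (α β g : ℕ) (S : Finset ι)
    (hv : ∀ i ∈ S, v' i = φ (v i)) : leadC v' α β g S = φ (leadC v α β g S) := by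
  rw [leadC, leadC, twoC, twoC, coeff_yc, coeff_yc,
    twoS_map (Polynomial.mapRingHom φ) Polynomial.X Polynomial.X (fun i => Polynomial.C (v i))
      (fun i => Polynomial.C (v' i)) α β S (by simp) (fun i hi => by simp [hv i hi]),
    PowerSeries.coeff_map, Polynomial.coe_mapRingHom, Polynomial.coeff_map]

lemma optS_insert_of_sq_eq_zero (s : A) (v : ι → A) {i : ι} {S : Finset ι} (hε : v i ^ 2 = 0)
    (hi : i ∉ S) : optS s v (insert i S) =
      PowerSeries.C (s + ∑ j ∈ S, v j) * optS s v S +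
        PowerSeries.C (v i) * (eul (optS s v) S + optS s v S) := by
  have h := ptS_insert_of_sq_eq_zero (fun o : Option ι => o.elim s v) (i := some i) hε
    (insert none (S.map Function.Embedding.some)) (by simp [hi]) (insert_nonempty _ _)
  rw [Finset.sum_insert (none_notMem_map_some S), sum_map_some, eul,
    card_insert_of_notMem (none_notMem_map_some S), card_map] at h
  rw [optS, map_insert, insert_comm]
  refine Eq.trans h ?_
  simp only [eul, optS, Option.elim_none, Option.elim_some]
  push_cast
  ring

lemma powOptS_insert_of_sq_eq_zero (s : A) (v : ι → A) (α : ℕ) {i : ι} {S : Finset ι}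
    (hε : v i ^ 2 = 0) (hi : i ∉ S) : powOptS s v α (insert i S) =
      powOptS s v (α + 1) S +
        PowerSeries.C (v i) * (eul (powOptS s v α) S + (α + 1) * powOptS s v α S) := by
  have hε2 : PowerSeries.C (v i) ^ 2 = 0 := by rw [← map_pow, hε, map_zero]
  have h1 : powOptS s v α = fun I => PowerSeries.C ((s + ∑ i ∈ I, v i) ^ α) * optS s v I := by
    funext I
    simp [powOptS]
  have heul : eul (powOptS s v α) S =
      PowerSeries.C (s + ∑ i ∈ S, v i) ^ α * eul (optS s v) S := by
    rw [h1, eul_C_mul, ← map_pow]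
  have hpow : ∀ u : PowerSeries A, (u + PowerSeries.C (v i)) ^ α * u =
      u ^ (α + 1) + α * u ^ α * PowerSeries.C (v i) ∧
      (u + PowerSeries.C (v i)) ^ α * PowerSeries.C (v i) = u ^ α * PowerSeries.C (v i) := by
    intro u
    generalize PowerSeries.C (v i) = ε at hε2
    clear heul h1
    induction α with
    | zero => simp
    | succ n ih =>
      obtain ⟨h1, h2⟩ := ih
      refine ⟨?_, ?_⟩
      · push_cast
        linear_combination (u + ε) * h1 + n * u ^ n * hε2
      · linear_combination (u + ε) * h2 + u ^ n * hε2
  obtain ⟨h2, h3⟩ := hpow (PowerSeries.C (s + ∑ j ∈ S, v j))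
  rw [heul]
  simp only [powOptS]
  rw [optS_insert_of_sq_eq_zero s v hε hi, Finset.sum_insert hi, add_left_comm, add_comm (v i),
    map_add PowerSeries.C (s + ∑ j ∈ S, v j)]
  linear_combination optS s v S * h2 + (eul (optS s v) S + optS s v S) * h3

lemma twoS_insert_of_sq_eq_zero (s : A) (v : ι → A) (α β : ℕ) {i : ι} {S : Finset ι}
    (hε : v i ^ 2 = 0) (hi : i ∉ S) : twoS s v α β (insert i S) =
      PowerSeries.C (∑ j ∈ S, v j) * twoS s v α β S +
        PowerSeries.C (v i) * (eul (twoS s v α β) S + (α + β + 2) * twoS s v α β S) := by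
  have hsub : ∀ (s : A) (α : ℕ) (I : Finset ι), i ∉ I → powOptS s v α (insert i I) =
      (powOptS s v (α + 1) + ((fun I => PowerSeries.C (v i) * eul (powOptS s v α) I) +
        fun I => (PowerSeries.C (v i) * (α + 1)) * powOptS s v α I)) I :=
    fun s α I hI => by
      rw [powOptS_insert_of_sq_eq_zero s v α hε hI]
      simp only [Pi.add_apply]
      ring
  rw [sum_mul_twoS]
  simp only [twoS]
  rw [conv_insert _ _ hi,
    conv_congr (f := fun I => powOptS s v α (insert i I)) (g' := powOptS (-s) v β)
      (fun I hI => hsub s α I fun h => hi (hI h)) fun _ _ => rfl,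
    conv_congr (g := fun I => powOptS (-s) v β (insert i I)) (f' := powOptS s v α)
      (fun _ _ => rfl) fun I hI => hsub (-s) β I fun h => hi (hI h)]
  simp only [conv_add_left, conv_add_right, conv_const_mul_left, conv_const_mul_right, eul_conv,
    Pi.add_apply]
  ring

lemma twoC_insert_of_sq_eq_zero (v : ι → A) (α β d : ℕ) {i : ι} {S : Finset ι}
    (hε : v i ^ 2 = 0) (hi : i ∉ S) : twoC v α β d (insert i S) =
      PowerSeries.C (∑ j ∈ S, v j) * twoC v α β d S +
        PowerSeries.C (v i) * (eul (twoC v α β d) S + (α + β + 2 : ℕ) * twoC v α β d S) := by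
  have h := congrArg (yc d) (twoS_insert_of_sq_eq_zero Polynomial.X (fun i => Polynomial.C (v i))
    α β (i := i) (by rw [← map_pow, hε, map_zero]) hi)
  have h1 : ∀ f : PowerSeries (Polynomial A), yc d (PowerSeries.C (Polynomial.C (v i)) * f) =
      PowerSeries.C (v i) * yc d f := fun f => by rw [← yc_map_mul, PowerSeries.map_C]
  have h2 : (α + β + 2 : PowerSeries (Polynomial A)) = (α + β + 2 : ℕ) := by push_cast; rfl
  rw [map_add, yc_C_sum_mul, h1, map_add, yc_eul, h2, yc_natCast_mul] at h
  exact h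

lemma leadC_insert_of_sq_eq_zero (v : ι → A) (α β g : ℕ) {i : ι} {S : Finset ι}
    (hε : v i ^ 2 = 0) (hi : i ∉ S) : leadC v α β g (insert i S) =
      (∑ j ∈ S, v j) * leadC v α β g S +
        v i * ((2 * g + α + β + 2 + S.card : ℕ) * leadC v α β g S) := by
  rw [leadC, twoC_insert_of_sq_eq_zero v _ _ _ hε hi, map_add, PowerSeries.coeff_C_mul,
    PowerSeries.coeff_C_mul, map_add, coeff_eul, ← map_natCast (PowerSeries.C (R := A)),
    PowerSeries.coeff_C_mul, ← leadC]
  push_cast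
  ring

end LeadingCoefficient

section Coefficients

variable {ι : Type*} [DecidableEq ι]

lemma weight_indicator (M : Finset ι) (d : ι →₀ ℕ) :
    Finsupp.weight (fun i => if i ∈ M then 1 else 0 : ι → ℕ) d = ∑ i ∈ M, d i := by
  rw [Finsupp.weight_apply, Finsupp.sum]
  simp only [smul_eq_mul, mul_ite, mul_one, mul_zero]
  rw [← Finset.sum_filter, filter_mem_eq_inter, inter_comm]
  exact Finset.sum_subset inter_subset_left fun i hi hi' => by simpa [hi] using hi'

lemma isWeightedHomogeneous_leadC (w : ι → ℕ) (α β g : ℕ) {S : Finset ι} (hw : ∀ i ∈ S, w i = 0) :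
    IsWeightedHomogeneous w (leadC (X : ι → MvPolynomial ι ℚ) α β g S) 0 := by
  classical
  set φ : MvPolynomial ι ℚ →ₐ[ℚ] MvPolynomial ι ℚ := aeval fun i => if w i = 0 then X i else 0
  have hφ : ∀ p, IsWeightedHomogeneous w (φ p) 0 := by
    intro p
    induction p using MvPolynomial.induction_on with
    | C a =>
      rw [← MvPolynomial.algebraMap_eq, φ.commutes]
      exact isWeightedHomogeneous_C w a
    | add p q hp hq =>
      rw [map_add]
      exact hp.add hq
    | mul_X p i hp =>
      rw [map_mul]
      refine (hp.mul (n := 0) ?_)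
      simp only [φ, aeval_X]
      split_ifs with h
      · simpa [h] using isWeightedHomogeneous_X ℚ w i
      · exact isWeightedHomogeneous_zero ℚ w 0
  have h := leadC_map (φ : MvPolynomial ι ℚ →+* MvPolynomial ι ℚ) X X α β g S
    fun i hi => by simp [φ, hw i hi]
  rw [h]
  exact hφ _

lemma isWeightedHomogeneous_sum_X (w : ι → ℕ) {S : Finset ι} {m : ℕ} (hw : ∀ i ∈ S, w i = m) :
    IsWeightedHomogeneous w (∑ i ∈ S, X i : MvPolynomial ι ℚ) m :=
  IsWeightedHomogeneous.sum _ _ _ fun i hi => hw i hi ▸ isWeightedHomogeneous_X ℚ w i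

lemma isWeightedHomogeneous_ptH_zero (w : ι → ℕ) (S : Finset ι) (hw : ∀ i ∈ S, w i = 1) :
    IsWeightedHomogeneous w (ptH (X : ι → MvPolynomial ι ℚ) S 0) (S.card - 1) := by
  induction S using Finset.strongInduction with
  | H S ih =>
  rcases lt_trichotomy S.card 1 with h | h | h
  · rw [Finset.card_eq_zero.1 (Nat.lt_one_iff.1 h), ptH_empty]
    exact isWeightedHomogeneous_zero ℚ w _
  · rw [ptH_of_card_eq_one _ h, h]
    exact isWeightedHomogeneous_one ℚ w
  have hc : IsWeightedHomogeneous w (6 * (∑ i ∈ S, X i) *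
      PowerSeries.coeff 0 (conv (ptS (X : ι → MvPolynomial ι ℚ)) (ptS X) S)) (S.card - 1) := by
    have h6 : (6 : MvPolynomial ι ℚ) = C 6 := (map_ofNat C 6).symm
    rw [h6, mul_assoc]
    refine IsWeightedHomogeneous.C_mul ?_ _
    rw [show S.card - 1 = 1 + (S.card - 2) by omega]
    refine (isWeightedHomogeneous_sum_X w hw).mul ?_
    rw [conv, map_sum]
    refine IsWeightedHomogeneous.sum _ _ _ fun I hI => ?_
    rw [mem_powerset] at hI
    rw [PowerSeries.coeff_mul]
    simp only [coeff_ptS]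
    rcases eq_or_ne I S with rfl | hne
    · simpa using isWeightedHomogeneous_zero ℚ w _
    rcases I.eq_empty_or_nonempty with rfl | hI'
    · simpa using isWeightedHomogeneous_zero ℚ w _
    have hss : I ⊂ S := ssubset_of_subset_of_ne hI hne
    have h1 := ih I hss fun i hi => hw i (hI hi)
    have h2 := ih (S \ I) (sdiff_ssubset hI hI') fun i hi => hw i (mem_sdiff.1 hi).1
    have h3 := card_sdiff_add_card_eq_card hI
    have h4 := hI'.card_pos
    have h5 := card_lt_card hss
    have := h1.mul h2
    rw [show I.card - 1 + ((S \ I).card - 1) = S.card - 2 by omega] at this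
    simpa using this
  have hr := ptH_rec (X : ι → MvPolynomial ι ℚ) S 0
  intro d hd
  refine hc (d := d) ?_
  rw [if_neg (lt_irrefl 0), zero_add] at hr
  have hC : (12 * (2 * ((0 : ℕ) : MvPolynomial ι ℚ) + (S.card : MvPolynomial ι ℚ) - 1)) =
      C (12 * ((S.card : ℚ) - 1)) := by
    simp [map_ofNat C 12]
  rw [← hr, hC, coeff_C_mul]
  have : (1 : ℚ) < S.card := by exact_mod_cast h
  exact mul_ne_zero (by linarith) hd

lemma tsub_single_one_apply (d : ι →₀ ℕ) (i j : ι) :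
    (d - Finsupp.single i 1 : ι →₀ ℕ) j = if j = i then d i - 1 else d j := by
  rw [Finsupp.tsub_apply, Finsupp.single_apply]
  rcases eq_or_ne j i with rfl | h
  · simp
  · simp [h, h.symm]

lemma coeff_leadC_of_two_le (α β g : ℕ) (S : Finset ι) (d : ι →₀ ℕ) (hd : ∀ i ∈ S, 2 ≤ d i) :
    4 * ((2 * (g + 1) + S.card : ℕ) * coeff d (leadC (X : ι → MvPolynomial ι ℚ) α β (g + 1) S)) =
      ∑ i ∈ S, coeff (d - Finsupp.single i 1) (leadC (X : ι → MvPolynomial ι ℚ) (α + 2) β g S) := by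
  have h0 : ∀ I ∈ S.powerset.erase S, coeff d ((∑ i ∈ I, (X i : MvPolynomial ι ℚ) +
      ((α : MvPolynomial ι ℚ) + (β : MvPolynomial ι ℚ) + 2) * ∑ i ∈ S \ I, X i) *
      leadC (X : ι → MvPolynomial ι ℚ) α β (g + 1) I * ptH X (S \ I) 0) = 0 := by
    intro I hI
    obtain ⟨hne, hI⟩ := mem_erase.1 hI
    rw [mem_powerset] at hI
    have hpos : 0 < (S \ I).card :=
      (sdiff_nonempty.2 fun h => hne (hI.antisymm h)).card_pos
    set w : ι → ℕ := fun i => if i ∈ S \ I then 1 else 0 with hw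
    have hwI : ∀ i ∈ I, w i = 0 := fun i hi => by simp [hw, hi]
    have hwS : ∀ i ∈ S \ I, w i = 1 := fun i hi => if_pos hi
    have hdw : 2 * (S \ I).card ≤ Finsupp.weight w d := by
      rw [hw, weight_indicator, mul_comm, ← smul_eq_mul]
      exact Finset.card_nsmul_le_sum _ _ _ fun i hi => hd i (mem_sdiff.1 hi).1
    have hL := isWeightedHomogeneous_leadC w α β (g + 1) hwI
    have hP := isWeightedHomogeneous_ptH_zero w (S \ I) hwS
    have h1 := ((isWeightedHomogeneous_sum_X w hwI).mul hL).mul hP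
    have h2 := (((isWeightedHomogeneous_sum_X w hwS).C_mul (α + β + 2 : ℚ)).mul hL).mul hP
    rw [add_mul, add_mul, coeff_add, h1.coeff_eq_zero d (by omega)]
    have h3 := h2.coeff_eq_zero d (by omega)
    simpa [map_ofNat C 2] using h3
  have h := congrArg (coeff d) (leadC_rec (X : ι → MvPolynomial ι ℚ) α β (g + 1) S)
  have h12 : (12 : MvPolynomial ι ℚ) = C 12 := (map_ofNat C 12).symm
  have h3 : (3 : MvPolynomial ι ℚ) = C 3 := (map_ofNat C 3).symm
  rw [if_pos g.succ_pos, coeff_add, ← map_natCast C, h12, h3, coeff_C_mul,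
    coeff_C_mul, coeff_C_mul, coeff_C_mul, coeff_sum, Finset.sum_eq_zero h0, Finset.sum_mul,
    coeff_sum, Nat.add_sub_cancel] at h
  have h4 : ∀ i ∈ S, coeff d (X i * leadC (X : ι → MvPolynomial ι ℚ) (α + 2) β g S) =
      coeff (d - Finsupp.single i 1) (leadC (X : ι → MvPolynomial ι ℚ) (α + 2) β g S) :=
    fun i hi => by
      rw [coeff_X_mul', if_pos]
      rw [Finsupp.mem_support_iff]
      have := hd i hi
      omega
  rw [Finset.sum_congr rfl h4] at h
  linarith

lemma coeff_leadC_insert (α β g : ℕ) {S : Finset ι} {i : ι} (hi : i ∉ S) (d : ι →₀ ℕ)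
    (hd : d i = 1) : coeff d (leadC (X : ι → MvPolynomial ι ℚ) α β g (insert i S)) =
      (2 * g + α + β + 2 + S.card : ℕ) *
        coeff (d - Finsupp.single i 1) (leadC (X : ι → MvPolynomial ι ℚ) α β g S) := by
  set c := leadC (X : ι → MvPolynomial ι ℚ) α β g S with hc
  set J : Ideal (MvPolynomial ι ℚ) := Ideal.span {X i ^ 2} with hJ
  have hmem : leadC X α β g (insert i S) -
      ((∑ j ∈ S, X j) * c + X i * (((2 * g + α + β + 2 + S.card : ℕ) : MvPolynomial ι ℚ) * c)) ∈ J := by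
    have h := leadC_insert_of_sq_eq_zero (fun j => Ideal.Quotient.mk J (X j)) α β g (i := i) (S := S)
      (by rw [← map_pow, Ideal.Quotient.eq_zero_iff_mem]; exact Ideal.mem_span_singleton_self _) hi
    rw [leadC_map (Ideal.Quotient.mk J) X _ α β g _ fun _ _ => rfl,
      leadC_map (Ideal.Quotient.mk J) X _ α β g _ fun _ _ => rfl] at h
    rw [← Ideal.Quotient.eq, h, map_add, map_mul, map_mul, map_mul, map_natCast, map_sum]
  rw [Ideal.mem_span_singleton'] at hmem
  obtain ⟨r, hr⟩ := hmem
  have h := congrArg (coeff d) hr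
  have h1 : coeff d (r * X i ^ 2) = 0 := by
    rw [sq, ← mul_assoc, coeff_mul_X']
    split_ifs with h
    · rw [coeff_mul_X', if_neg]
      simp [hd]
    · rfl
  have h2 : coeff d ((∑ j ∈ S, X j) * c) = 0 := by
    set w : ι → ℕ := fun j => if j ∈ ({i} : Finset ι) then 1 else 0 with hw
    have hwS : ∀ j ∈ S, w j = 0 := fun j hj => by
      rw [hw]
      simp only [mem_singleton]
      exact if_neg (by rintro rfl; exact hi hj)
    refine ((isWeightedHomogeneous_sum_X w hwS).mul
      (isWeightedHomogeneous_leadC w α β g hwS)).coeff_eq_zero d ?_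
    rw [hw, weight_indicator]
    simp [hd]
  rw [h1, coeff_sub, coeff_add, h2, coeff_X_mul', if_pos (by simp [hd]), ← map_natCast C,
    coeff_C_mul] at h
  linarith

theorem coeff_leadC (α β g : ℕ) (S : Finset ι) (d : ι →₀ ℕ) (hd1 : ∀ i ∈ S, 1 ≤ d i)
    (hd0 : ∀ i ∉ S, d i = 0) (hsum : ∑ i ∈ S, d i = g + S.card) :
    coeff d (leadC (X : ι → MvPolynomial ι ℚ) α β g S) *
      ((2 * g + α + β + 1).factorial * 4 ^ g * ∏ i ∈ S, (Nat.doubleFactorial (2 * d i - 1) : ℚ)) =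
    (-1) ^ β * (2 * g + α + β + 1 + S.card).factorial := by
  induction hN : g + S.card using Nat.strong_induction_on generalizing α g S d with
  | _ N ih =>
  subst hN
  by_cases h1 : ∃ i ∈ S, d i = 1
  · obtain ⟨i, hi, hdi⟩ := h1
    obtain ⟨T, hiT, rfl⟩ : ∃ T, i ∉ T ∧ insert i T = S :=
      ⟨S.erase i, notMem_erase i S, insert_erase hi⟩
    have hne : ∀ j ∈ T, (d - Finsupp.single i 1 : ι →₀ ℕ) j = d j := fun j hj => by
      rw [tsub_single_one_apply, if_neg (by rintro rfl; exact hiT hj)]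
    rw [card_insert_of_notMem hiT, Finset.sum_insert hiT, hdi] at hsum
    have h := ih (g + T.card) (by rw [card_insert_of_notMem hiT]; omega) α g T
      (d - Finsupp.single i 1) (fun j hj => by rw [hne j hj]; exact hd1 j (mem_insert_of_mem hj))
      (fun j hj => by
        by_cases hij : j = i
        · simp [hij, hdi]
        · simp [hd0 j (by simp [hij, hj])])
      (by rw [Finset.sum_congr rfl hne]; exact Nat.add_left_cancel (hsum.trans (by ring))) rfl
    rw [Finset.prod_congr rfl fun j hj => by rw [hne j hj]] at h
    rw [coeff_leadC_insert α β g hiT d hdi, Finset.prod_insert hiT, hdi, card_insert_of_notMem hiT,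
      ← add_assoc, Nat.factorial_succ (2 * g + α + β + 1 + T.card)]
    have h1 : Nat.doubleFactorial (2 * 1 - 1) = 1 := rfl
    simp only [h1, Nat.cast_one, Nat.cast_mul, Nat.cast_add, Nat.cast_ofNat]
    linear_combination (2 * g + α + β + 2 + T.card : ℚ) * h
  · have hd2 : ∀ i ∈ S, 2 ≤ d i := fun i hi => by
      have := hd1 i hi
      have : d i ≠ 1 := fun h => h1 ⟨i, hi, h⟩
      omega
    rcases S.eq_empty_or_nonempty with rfl | hS
    · obtain rfl : g = 0 := by simpa using hsum.symm
      have hd : d = 0 := Finsupp.ext fun i => hd0 i (by simp)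
      subst hd
      have : ((-1) ^ β : MvPolynomial ι ℚ) = C ((-1) ^ β) := by simp
      rw [leadC_empty_zero, this, coeff_C, if_pos rfl]
      simp
    have hg : 0 < g := by
      have := hS.card_pos
      have h2 := Finset.card_nsmul_le_sum S d 2 hd2
      rw [hsum, smul_eq_mul] at h2
      omega
    obtain ⟨g, rfl⟩ := Nat.exists_eq_succ_of_ne_zero hg.ne'
    have hrec := coeff_leadC_of_two_le α β g S d hd2
    have hdf : ∀ i ∈ S, ∏ j ∈ S, (Nat.doubleFactorial (2 * d j - 1) : ℚ) = (2 * d i - 1) *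
        ∏ j ∈ S, (Nat.doubleFactorial (2 * (d - Finsupp.single i 1 : ι →₀ ℕ) j - 1) : ℚ) := by
      intro i hi
      rw [← Finset.mul_prod_erase S _ hi, ← Finset.mul_prod_erase S _ hi, ← mul_assoc]
      congr 1
      · obtain ⟨m, hm⟩ := Nat.exists_eq_add_of_le (hd2 i hi)
        rw [tsub_single_one_apply, if_pos rfl, hm, show 2 * (2 + m) - 1 = (2 * m + 1) + 2 by omega, Nat.doubleFactorial,
          show 2 * (2 + m - 1) - 1 = 2 * m + 1 by omega]
        push_cast
        ring
      · refine Finset.prod_congr rfl fun j hj => ?_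
        rw [tsub_single_one_apply, if_neg (ne_of_mem_erase hj)]
    set P := ∏ j ∈ S, (Nat.doubleFactorial (2 * d j - 1) : ℚ) with hP
    have hterm : ∀ i ∈ S,
        coeff (d - Finsupp.single i 1) (leadC (X : ι → MvPolynomial ι ℚ) (α + 2) β g S) *
          ((2 * (g + 1) + α + β + 1).factorial * 4 ^ g * P) =
        (2 * d i - 1) * ((-1) ^ β * (2 * (g + 1) + α + β + 1 + S.card).factorial) := by
      intro i hi
      have hs := tsub_single_one_apply d i
      have h := ih (g + S.card) (by omega) (α + 2) g S (d - Finsupp.single i 1)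
        (fun j hj => by
          rw [hs]
          have := hd2 j hj
          have := hd2 i hi
          split_ifs <;> omega)
        (fun j hj => by simp [hd0 j hj])
        (by
          have h3 : ∑ j ∈ S, Finsupp.single i 1 j = 1 := by
            rw [Finset.sum_eq_single i (fun j _ hj => by simp [hj.symm])
              (fun h => absurd hi h)]
            simp
          have h4 : ∑ j ∈ S, ((d - Finsupp.single i 1 : ι →₀ ℕ) j + Finsupp.single i 1 j) = ∑ j ∈ S, d j :=
            Finset.sum_congr rfl fun j _ => by
              rw [hs]
              have := hd2 i hi
              by_cases hij : j = i
              · rw [if_pos hij, hij, Finsupp.single_eq_same]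
                omega
              · simp [hij]
          rw [Finset.sum_add_distrib, h3, hsum] at h4
          omega) rfl
      rw [show 2 * g + (α + 2) + β + 1 = 2 * (g + 1) + α + β + 1 by ring] at h
      rw [hdf i hi]
      linear_combination (2 * d i - 1 : ℚ) * h
    have htot := Finset.sum_congr rfl hterm
    rw [← Finset.sum_mul, ← hrec, ← Finset.sum_mul] at htot
    have hsum' : ∑ i ∈ S, (2 * (d i : ℚ) - 1) = (2 * (g + 1) + S.card : ℕ) := by
      rw [Finset.sum_sub_distrib, ← Finset.mul_sum, ← Nat.cast_sum, hsum]
      simp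
      ring
    rw [hsum'] at htot
    have hne : ((2 * (g + 1) + S.card : ℕ) : ℚ) ≠ 0 := by positivity
    refine mul_left_cancel₀ hne ?_
    rw [← htot, Nat.succ_eq_add_one]
    ring

end Coefficients

section Normalized

variable {ι ι' A A' : Type*} [DecidableEq ι] [DecidableEq ι'] [CommRing A] [Algebra ℚ A]
  [CommRing A'] [Algebra ℚ A']

/-- The exponential series `exp (a t / 24)`. -/
def expS (a : A) : PowerSeries A :=
  PowerSeries.rescale (algebraMap ℚ A 24⁻¹ * a) (PowerSeries.exp A)

lemma coeff_expS (a : A) (d : ℕ) :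
    PowerSeries.coeff d (expS a) = (algebraMap ℚ A 24⁻¹ * a) ^ d * algebraMap ℚ A (1 / d.factorial) := by
  rw [expS, PowerSeries.coeff_rescale, PowerSeries.coeff_exp]

lemma expS_add (a b : A) : expS (a + b) = expS a * expS b := by
  rw [expS, expS, expS, PowerSeries.exp_mul_exp_eq_exp_add, mul_add]

lemma expS_zero : expS (0 : A) = 1 := by
  ext d
  rw [coeff_expS, PowerSeries.coeff_one]
  rcases d with _ | d <;> simp

lemma theta_expS (a : A) : 24 * theta (expS a) = PowerSeries.X * (PowerSeries.C a * expS a) := by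
  have h24 : (24 : PowerSeries A) = PowerSeries.C (algebraMap ℚ A 24) := by
    rw [map_ofNat, map_ofNat]
  ext d
  rw [h24, PowerSeries.coeff_C_mul, coeff_theta]
  rcases d with _ | d
  · simp
  rw [PowerSeries.coeff_succ_X_mul, PowerSeries.coeff_C_mul, coeff_expS, coeff_expS]
  have h1 : ((d + 1 : ℕ) : A) = algebraMap ℚ A (d + 1 : ℕ) := by simp
  have h2 : (d + 1 : ℕ) * (1 / ((d + 1).factorial : ℚ)) = 1 / d.factorial := by
    rw [Nat.factorial_succ]
    push_cast
    field_simp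
  have h3 : algebraMap ℚ A 24 * algebraMap ℚ A 24⁻¹ = 1 := by
    rw [← map_mul]
    norm_num
  rw [h1, ← h2, map_mul (algebraMap ℚ A), pow_succ]
  linear_combination (algebraMap ℚ A 24⁻¹ * a) ^ d * a * algebraMap ℚ A (d + 1 : ℕ) *
    algebraMap ℚ A (1 / ((d + 1).factorial : ℚ)) * h3

lemma expS_map (φ : A →+* A') (a : A) : expS (φ a) = PowerSeries.map φ (expS a) := by
  ext d
  rw [PowerSeries.coeff_map, coeff_expS, coeff_expS]
  simp only [map_mul, map_pow]
  simp only [← RingHom.comp_apply, Subsingleton.elim (φ.comp (algebraMap ℚ A)) (algebraMap ℚ A')]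

/-- The generating series of the normalized `n`-point functions, multiplied by the square of the
sum of the variables. -/
def normS (v : ι → A) (S : Finset ι) : PowerSeries A := expS (-∑ i ∈ S, v i ^ 3) * ptS v S

lemma normS_empty (v : ι → A) : normS v ∅ = 0 := by
  rw [normS, ptS_empty, mul_zero]

lemma ptS_eq_expS_mul_normS (v : ι → A) (S : Finset ι) :
    ptS v S = expS (∑ i ∈ S, v i ^ 3) * normS v S := by
  rw [normS, ← mul_assoc, ← expS_add, add_neg_cancel, expS_zero, one_mul]

lemma normS_map (φ : A →+* A') (f : ι ↪ ι') (v : ι → A) (v' : ι' → A') (S : Finset ι)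
    (hv : ∀ i ∈ S, v' (f i) = φ (v i)) : normS v' (S.map f) = PowerSeries.map φ (normS v S) := by
  have h : ptS v' (S.map f) = PowerSeries.map φ (ptS v S) := by
    ext g
    rw [PowerSeries.coeff_map, coeff_ptS, coeff_ptS, ptH_map φ f v v' S hv]
  rw [normS, normS, h, map_mul, ← expS_map, Finset.sum_map, map_neg, map_sum φ]
  simp only [map_pow]
  rw [Finset.sum_congr rfl fun i hi => by rw [hv i hi]]

lemma conv_normS (v : ι → A) (S : Finset ι) :
    conv (normS v) (normS v) S = expS (-∑ i ∈ S, v i ^ 3) * conv (ptS v) (ptS v) S := by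
  rw [conv, conv, Finset.mul_sum]
  refine Finset.sum_congr rfl fun I hI => ?_
  rw [← Finset.sum_sdiff (mem_powerset.1 hI), neg_add, expS_add, normS, normS]
  ring

lemma eul_normS (v : ι → A) (S : Finset ι) :
    12 * (eul (normS v) S - normS v S) =
      PowerSeries.X * (PowerSeries.C ((∑ i ∈ S, v i) ^ 3 - ∑ i ∈ S, v i ^ 3) * normS v S) +
        6 * PowerSeries.C (∑ i ∈ S, v i) * conv (normS v) (normS v) S := by
  have h := eul_ptS v S
  have h2 := theta_expS (-∑ i ∈ S, v i ^ 3)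
  rw [conv_normS, eul, normS, theta_mul, map_sub PowerSeries.C, map_pow PowerSeries.C]
  rw [map_neg PowerSeries.C] at h2
  rw [eul] at h
  linear_combination expS (-∑ i ∈ S, v i ^ 3) * h + ptS v S * h2

lemma coeff_normS_rec (v : ι → A) (S : Finset ι) (g : ℕ) :
    (12 * (2 * g + S.card - 1) : A) * PowerSeries.coeff g (normS v S) =
      (if 0 < g then ((∑ i ∈ S, v i) ^ 3 - ∑ i ∈ S, v i ^ 3) *
        PowerSeries.coeff (g - 1) (normS v S) else 0) +
      6 * (∑ i ∈ S, v i) * PowerSeries.coeff g (conv (normS v) (normS v) S) := by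
  have h12 : (12 : PowerSeries A) = PowerSeries.C 12 := (map_ofNat _ 12).symm
  have h6 : (6 : PowerSeries A) = PowerSeries.C 6 := (map_ofNat _ 6).symm
  have h := congrArg (PowerSeries.coeff g) (eul_normS v S)
  rw [h12, h6, PowerSeries.coeff_C_mul, map_sub, coeff_eul, map_add, mul_assoc,
    PowerSeries.coeff_C_mul, PowerSeries.coeff_C_mul] at h
  have h1 : PowerSeries.coeff g (PowerSeries.X * (PowerSeries.C ((∑ i ∈ S, v i) ^ 3 -
      ∑ i ∈ S, v i ^ 3) * normS v S)) = if 0 < g then ((∑ i ∈ S, v i) ^ 3 - ∑ i ∈ S, v i ^ 3) *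
        PowerSeries.coeff (g - 1) (normS v S) else 0 := by
    rcases g with _ | g
    · simp
    · rw [PowerSeries.coeff_succ_X_mul, PowerSeries.coeff_C_mul, if_pos g.succ_pos,
        Nat.add_sub_cancel]
  rw [h1] at h
  push_cast at h
  linear_combination h

lemma normS_of_card_eq_one (v : ι → A) {S : Finset ι} (hS : S.card = 1) : normS v S = 1 := by
  obtain ⟨i, rfl⟩ := Finset.card_eq_one.1 hS
  have hconv : conv (normS v) (normS v) {i} = 0 := by
    rw [conv_normS, conv]
    refine mul_eq_zero_of_right _ (Finset.sum_eq_zero fun I hI => ?_)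
    rcases Finset.subset_singleton_iff.1 (mem_powerset.1 hI) with rfl | rfl <;> simp
  ext g
  rw [PowerSeries.coeff_one]
  rcases g with _ | g
  · rw [normS, PowerSeries.coeff_mul]
    simp [coeff_expS, ptH_singleton_zero]
  · have h := coeff_normS_rec v {i} (g + 1)
    rw [hconv, map_zero, mul_zero, add_zero, Finset.sum_singleton, Finset.sum_singleton, sub_self,
      zero_mul, ite_self, card_singleton] at h
    rw [if_neg g.succ_ne_zero]
    refine natCast_mul_cancel (n := 24 * (g + 1)) (by omega) ?_
    push_cast at h ⊢
    linear_combination h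

end Normalized

lemma eq_sum_doubleFactorial_of_rec {F : Type*} [Field F] [CharZero F] (m : ℕ) (D s : F) (E c : ℕ → F)
    (h : ∀ g : ℕ, (12 * (2 * g + (m + 2 : ℕ) - 1) : F) * E g =
      (if 0 < g then 3 * D * E (g - 1) else 0) + 6 * s * c g) (g : ℕ) :
    E g = ∑ k ∈ Finset.range (g + 1),
      ((Nat.doubleFactorial (2 * (g - k) + (m + 2) - 3) : F) /
        (4 ^ k * Nat.doubleFactorial (2 * g + (m + 2) - 1))) * (s / 2 * c (g - k)) * D ^ k := by
  have hne : ∀ g : ℕ, (2 * g + m + 1 : F) ≠ 0 := fun g => by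
    exact_mod_cast Nat.succ_ne_zero (2 * g + m)
  have hdf : ∀ k : ℕ, (Nat.doubleFactorial k : F) ≠ 0 := fun k => by
    exact_mod_cast (Nat.doubleFactorial_pos k).ne'
  have hdf1 : ∀ g : ℕ, (Nat.doubleFactorial (2 * g + (m + 2) - 1) : F) =
      (2 * g + m + 1) * Nat.doubleFactorial (2 * g + (m + 2) - 3) := fun g => by
    rw [show 2 * g + (m + 2) - 1 = 2 * g + m + 1 by omega, Nat.doubleFactorial_add_one,
      show 2 * g + (m + 2) - 3 = 2 * g + m - 1 by omega]
    push_cast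
    ring
  have hE : ∀ g, E g = ((if 0 < g then D / 4 * E (g - 1) else 0) + s / 2 * c g) / (2 * g + m + 1) :=
    fun g => by
      have := h g
      rw [eq_div_iff (hne g)]
      push_cast at this
      split_ifs at this ⊢ with hg
      · linear_combination this / 12
      · linear_combination this / 12
  induction g with
  | zero =>
    rw [hE 0]
    have h1 := hne 0
    have h2 := hdf (2 * 0 + (m + 2) - 3)
    rw [if_neg (lt_irrefl 0), zero_add, Finset.sum_range_one, Nat.sub_zero, pow_zero, pow_zero, hdf1]
    field_simp
  | succ g ih =>
    rw [hE (g + 1), if_pos g.succ_pos, Nat.add_sub_cancel, ih,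
      Finset.sum_range_succ' _ (g + 1), add_div, Finset.mul_sum, Finset.sum_div]
    congr 1
    · refine Finset.sum_congr rfl fun k hk => ?_
      have h2 := hdf1 (g + 1)
      rw [show 2 * (g + 1) + (m + 2) - 3 = 2 * g + (m + 2) - 1 by omega] at h2
      rw [h2, Nat.add_sub_add_right]
      have := hne (g + 1)
      have := hdf (2 * g + (m + 2) - 1)
      field_simp
      ring
    · rw [hdf1 (g + 1)]
      have := hne (g + 1)
      have := hdf (2 * (g + 1) + (m + 2) - 3)
      simp only [tsub_zero, pow_zero]
      field_simp

section NPoint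

variable {n : ℕ}

/-- The variables as elements of the field of rational functions. -/
def xK (n : ℕ) (i : Fin n) : K n := algebraMap (R n) (K n) (X i)

lemma algebraMap_sum_X (I : Finset (Fin n)) :
    algebraMap (R n) (K n) (∑ i ∈ I, X i) = ∑ i ∈ I, xK n i := map_sum _ _ _

lemma SX_eq : SX n = ∑ i, xK n i := map_sum _ _ _

lemma SX3_eq : SX3 n = ∑ i, xK n i ^ 3 := by
  simp only [SX3, map_sum, map_pow, xK]

lemma SX_ne_zero (hn : n ≠ 0) : SX n ≠ 0 := by
  rw [SX, Ne, FaithfulSMul.algebraMap_eq_zero_iff]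
  intro h
  have := congrArg (eval fun _ => (1 : ℚ)) h
  simp [hn] at this

lemma emb_xK (I : Finset (Fin n)) (i : Fin I.card) :
    emb I (xK I.card i) = xK n (I.orderEmbOfFin rfl i) := by
  rw [emb, xK, IsFractionRing.lift_algebraMap]
  simp [embRH, xK]

lemma emb_SX (I : Finset (Fin n)) : emb I (SX I.card) = ∑ i ∈ I, xK n i := by
  rw [SX_eq, map_sum]
  simp only [emb_xK]
  refine (Finset.sum_map univ (I.orderEmbOfFin rfl).toEmbedding (xK n)).symm.trans ?_
  rw [map_orderEmbOfFin_univ]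

lemma emb_coeff_normS (I : Finset (Fin n)) (g : ℕ) :
    emb I (PowerSeries.coeff g (normS (xK I.card) univ)) = PowerSeries.coeff g (normS (xK n) I) := by
  rw [← PowerSeries.coeff_map, ← normS_map (emb I) (I.orderEmbOfFin rfl).toEmbedding (xK I.card) (xK n)
    univ fun i _ => (emb_xK I i).symm, map_orderEmbOfFin_univ]

lemma sq_SX_mul_Gf_one (fuel g : ℕ) :
    SX 1 ^ 2 * Gf fuel 1 g = PowerSeries.coeff g (normS (xK 1) univ) := by
  rw [normS_of_card_eq_one _ (by simp)]
  rcases g with _ | g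
  · have h : SX 1 = algebraMap (R 1) (K 1) (X 0) := by simp [SX]
    have h0 := SX_ne_zero one_ne_zero
    have hG : Gf fuel 1 0 = (algebraMap (R 1) (K 1) (X 0)) ^ (-2 : ℤ) := by
      cases fuel <;> rw [Gf]
    rw [hG, ← h, zpow_neg, PowerSeries.coeff_zero_one]
    exact mul_inv_cancel₀ (pow_ne_zero 2 h0)
  · have hG : Gf fuel 1 (g + 1) = 0 := by
      cases fuel <;> rw [Gf]
    rw [hG, mul_zero, PowerSeries.coeff_one, if_neg g.succ_ne_zero]

theorem sq_SX_mul_Gf (fuel : ℕ) : ∀ n, n ≤ fuel + 1 → ∀ g,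
    SX n ^ 2 * Gf fuel n g = PowerSeries.coeff g (normS (xK n) univ) := by
  induction fuel with
  | zero =>
    intro n hn g
    match n, g with
    | 0, g => simp [Gf, normS_empty]
    | 1, g => exact sq_SX_mul_Gf_one _ g
  | succ fuel ih =>
    intro n hn g
    match n, g with
    | 0, g => simp [Gf, normS_empty]
    | 1, g => exact sq_SX_mul_Gf_one _ g
    | m + 2, g =>
      have hsub : ∀ I : Finset (Fin (m + 2)), I ≠ univ → ∀ r,
          (algebraMap (R (m + 2)) (K (m + 2)) (∑ i ∈ I, X i)) ^ 2 * emb I (Gf fuel I.card r) =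
            PowerSeries.coeff r (normS (xK (m + 2)) I) := by
        intro I hI r
        have hlt : I.card < m + 2 := by
          simpa using card_lt_card (ssubset_univ_iff.2 hI)
        rw [algebraMap_sum_X, ← emb_SX, ← map_pow, ← map_mul, ih _ (by omega), emb_coeff_normS]
      have hconv : ∀ r, SX (m + 2) ^ 2 * ((2 * SX (m + 2))⁻¹ * ∑ I : Finset (Fin (m + 2)),
            if I ≠ ∅ ∧ I ≠ univ then
              (algebraMap (R (m + 2)) (K (m + 2)) (∑ i ∈ I, X i)) ^ 2 *
              (algebraMap (R (m + 2)) (K (m + 2)) (∑ i ∈ Iᶜ, X i)) ^ 2 *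
              ∑ r' ∈ Finset.range (r + 1),
                emb I (Gf fuel I.card r') * emb Iᶜ (Gf fuel Iᶜ.card (r - r'))
            else 0) =
          SX (m + 2) / 2 * PowerSeries.coeff r (conv (normS (xK (m + 2))) (normS (xK (m + 2))) univ) := by
        intro r
        rw [← mul_assoc]
        congr 1
        · field_simp
        · rw [conv, powerset_univ, map_sum]
          refine Finset.sum_congr rfl fun I _ => ?_
          split_ifs with h
          · rw [PowerSeries.coeff_mul, Nat.sum_antidiagonal_eq_sum_range_succ_mk, Finset.mul_sum]
            refine Finset.sum_congr rfl fun r' _ => ?_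
            rw [← compl_eq_univ_sdiff, ← hsub I h.2, ← hsub Iᶜ (by simpa using h.1)]
            ring
          · rw [not_and_or, not_not, not_not] at h
            rcases h with rfl | rfl <;> simp [normS_empty]
      have hrec : ∀ g : ℕ, (12 * (2 * g + (m + 2 : ℕ) - 1) : K (m + 2)) *
          PowerSeries.coeff g (normS (xK (m + 2)) univ) =
          (if 0 < g then 3 * Dlt (m + 2) * PowerSeries.coeff (g - 1) (normS (xK (m + 2)) univ) else 0) +
          6 * SX (m + 2) *
            PowerSeries.coeff g (conv (normS (xK (m + 2))) (normS (xK (m + 2))) univ) := by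
        intro g
        have h := coeff_normS_rec (xK (m + 2)) univ g
        rw [card_univ, Fintype.card_fin, ← SX_eq, ← SX3_eq] at h
        rw [h, Dlt]
        congr 2
        ring
      rw [eq_sum_doubleFactorial_of_rec m (Dlt (m + 2)) (SX (m + 2)) _ _ hrec g, Gf, Finset.mul_sum]
      refine Finset.sum_congr rfl fun k hk => ?_
      rw [← hconv]
      push_cast
      ring

theorem sq_SX_mul_Fnpt (n g : ℕ) :
    SX n ^ 2 * Fnpt n g = algebraMap (R n) (K n) (ptH X univ g) := by
  have h := congrArg (PowerSeries.coeff g) (ptS_eq_expS_mul_normS (xK n) univ)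
  have hmap := ptH_map (algebraMap (R n) (K n)) (Function.Embedding.refl _) X (xK n) univ
    (fun _ _ => rfl) g
  rw [map_refl] at hmap
  rw [coeff_ptS, hmap, PowerSeries.coeff_mul, Nat.sum_antidiagonal_eq_sum_range_succ_mk] at h
  rw [h, Fnpt, Finset.mul_sum]
  refine Finset.sum_congr rfl fun d _ => ?_
  rw [← sq_SX_mul_Gf n n (Nat.le_succ n), coeff_expS, ← SX3_eq, Gnpt]
  simp only [map_div₀, map_one, map_natCast, map_inv₀, map_ofNat, Rat.cast_natCast]
  ring

/-- Away from the unstable cases, the `n`-point function is a polynomial. -/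
theorem sq_sum_mul_polyOf_Fnpt {n g : ℕ} (hn : n ≠ 0) (h : 2 < 2 * g + n) :
    (∑ i, X i) ^ 2 * polyOf (Fnpt n g) = ptH X univ g := by
  have hF := sq_SX_mul_Fnpt n g
  have hex : ∃ p : R n, algebraMap (R n) (K n) p = Fnpt n g := by
    obtain ⟨q, hq⟩ := sum_sq_dvd_ptH (X : Fin n → R n) univ (g := g) (by simpa using h)
    refine ⟨q, mul_left_cancel₀ (pow_ne_zero 2 (SX_ne_zero hn)) ?_⟩
    rw [hF, hq, map_mul, map_pow, SX]
  have hp : algebraMap (R n) (K n) (polyOf (Fnpt n g)) = Fnpt n g := by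
    rw [polyOf, dif_pos hex]
    exact hex.choose_spec
  refine IsFractionRing.injective (R n) (K n) ?_
  rw [map_mul, map_pow, hp, ← hF, SX]

end NPoint

lemma binomZ_zero (m : ℤ) : binomZ m 0 = 1 := by simp [binomZ]

lemma binomZ_succ_mul (m : ℤ) (k : ℕ) : binomZ m (k + 1) * (k + 1) = binomZ m k * (m - k) := by
  have : (k.factorial : ℚ) ≠ 0 := by exact_mod_cast k.factorial_ne_zero
  rw [binomZ, binomZ, Finset.prod_range_succ, Nat.factorial_succ]
  push_cast
  field_simp

lemma binomZ_add_one_succ (m : ℤ) (k : ℕ) :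
    binomZ (m + 1) (k + 1) = binomZ m (k + 1) + binomZ m k := by
  induction k with
  | zero => simp [binomZ]
  | succ k ih =>
    have h1 := binomZ_succ_mul (m + 1) (k + 1)
    have h2 := binomZ_succ_mul m (k + 1)
    have h3 := binomZ_succ_mul m k
    have h4 : ((k + 1 : ℕ) : ℚ) + 1 ≠ 0 := by positivity
    refine mul_right_cancel₀ h4 ?_
    rw [h1, add_mul, h2, ih]
    push_cast
    linear_combination -h3

lemma yExpAdd_zero {n : ℕ} (c : R n) : yExpAdd c 0 = 1 := by
  have h : (PowerSeries.mk fun k => MvPolynomial.C (binomZ 0 k) * c ^ k) = 1 := by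
    ext1 k
    rw [PowerSeries.coeff_mk, PowerSeries.coeff_one]
    cases k with
    | zero => simp [binomZ_zero]
    | succ k => simp [binomZ, Finset.prod_range_succ']
  rw [yExpAdd, h, neg_zero, HahnSeries.single_zero_one, one_mul, map_one]

lemma yExpAdd_add_one {n : ℕ} (c : R n) (m : ℤ) :
    yExpAdd c (m + 1) = yExpAdd c m * (HahnSeries.single (-1) 1 + HahnSeries.C c) := by
  have h : (PowerSeries.mk fun k => MvPolynomial.C (binomZ (m + 1) k) * c ^ k) =
      (PowerSeries.mk fun k => MvPolynomial.C (binomZ m k) * c ^ k) *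
        (1 + PowerSeries.C c * PowerSeries.X) := by
    ext1 k
    rw [mul_add, mul_one, ← mul_assoc, map_add]
    cases k with
    | zero => simp [binomZ_zero]
    | succ k =>
      rw [PowerSeries.coeff_succ_mul_X, PowerSeries.coeff_mul_C]
      simp only [PowerSeries.coeff_mk, binomZ_add_one_succ, map_add]
      ring
  have h1 : (HahnSeries.single (-(m + 1)) (1 : R n)) =
      HahnSeries.single (-m) 1 * HahnSeries.single (-1) 1 := by
    rw [HahnSeries.single_mul_single, mul_one, neg_add]
  have h2 : (HahnSeries.single (-1 : ℤ) (1 : R n)) * HahnSeries.single 1 1 = 1 := by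
    rw [HahnSeries.single_mul_single, mul_one]
    rfl
  rw [yExpAdd, yExpAdd, h, h1, map_mul, map_add, map_mul, map_one (HahnSeries.ofPowerSeries ℤ (R n)),
    HahnSeries.ofPowerSeries_C,
    HahnSeries.ofPowerSeries_X]
  linear_combination (HahnSeries.single (-m) (1 : R n) * HahnSeries.ofPowerSeries ℤ (R n)
      (PowerSeries.mk fun k => MvPolynomial.C (binomZ m k) * c ^ k)) * HahnSeries.C c * h2

lemma LExp_zero {n : ℕ} (σ : Bool) (c : R n) : LExp σ c 0 = 1 := by
  cases σ <;> simp [LExp, yExpAdd_zero]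

lemma LExp_add_one {n : ℕ} (σ : Bool) (c : R n) (m : ℤ) :
    LExp σ c (m + 1) = LExp σ c m * (yLau n σ + HahnSeries.C c) := by
  rw [LExp, LExp, yExpAdd_add_one, yLau]
  cases σ
  · by_cases hm : Even m
    · have hm' : ¬ Even (m + 1) := by simpa [Int.even_add_one] using hm
      simp only [hm, hm', if_true, if_false, Bool.false_eq_true, neg_mul, one_mul, map_neg]
      ring
    · have hm' : Even (m + 1) := by simpa [Int.even_add_one] using hm
      simp only [hm, hm', if_true, if_false, Bool.false_eq_true, neg_mul, one_mul, map_neg]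
      ring
  · simp

lemma LExp_natCast {n : ℕ} (σ : Bool) (c : R n) (m : ℕ) :
    LExp σ c m = (yLau n σ + HahnSeries.C c) ^ m := by
  induction m with
  | zero => simpa using LExp_zero σ c
  | succ m ih => rw [Nat.cast_succ, LExp_add_one, ih, pow_succ]

lemma LExp_neg_one_mul {n : ℕ} (σ : Bool) (c : R n) :
    LExp σ c (-1) * (yLau n σ + HahnSeries.C c) = 1 := by
  rw [← LExp_add_one, neg_add_cancel, LExp_zero]

lemma coeff_optS {ι B : Type*} [DecidableEq ι] [CommRing B] [Algebra ℚ B] (s : B) (v : ι → B)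
    (I : Finset ι) (g : ℕ) : PowerSeries.coeff g (optS s v I) =
      ptH (fun o : Option ι => o.elim s v) (insert none (I.map Function.Embedding.some)) g := by
  rw [optS, coeff_ptS]

lemma coeff_zero_optS_singleton {ι B : Type*} [DecidableEq ι] [CommRing B] [Algebra ℚ B] (s : B)
    (v : ι → B) (i : ι) : PowerSeries.coeff 0 (optS s v {i}) = s + v i := by
  have hne : (none : Option ι) ∉ ({some i} : Finset (Option ι)) := by simp
  have h := ptH_rec (fun o : Option ι => o.elim s v) {none, some i} 0
  rw [conv_insert _ _ hne] at h
  rw [coeff_optS, map_singleton, Function.Embedding.some_apply]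
  have hc : ({none, some i} : Finset (Option ι)).card = 2 := card_pair (by simp)
  have hP : ({some i} : Finset (Option ι)).powerset = {∅, {some i}} := rfl
  have h1 : ∀ o : Option ι, PowerSeries.constantCoeff (ptS (fun o : Option ι => o.elim s v) {o}) = 1 :=
    fun o => by
      rw [← PowerSeries.coeff_zero_eq_constantCoeff_apply, coeff_ptS, ptH_singleton_zero]
  simp [conv, hP, hc, h1] at h
  have : (12 : B) * ptH (fun o : Option ι => o.elim s v) {none, some i} 0 = 12 * (s + v i) := by
    linear_combination h
  exact natCast_mul_cancel (by norm_num) (n := 12) (by exact_mod_cast this)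

lemma sq_mul_eval₂_polyOf_Fnpt {n : ℕ} (σ : Bool) (g : ℕ) (I : Finset (Fin n))
    (h : 2 < 2 * g + (I.card + 1)) :
    (yLau n σ + HahnSeries.C (∑ i ∈ I, X i)) ^ 2 *
      MvPolynomial.eval₂ ((HahnSeries.C).comp (algebraMap ℚ (R n)))
      (Fin.cons (yLau n σ)
        (fun i : Fin I.card => HahnSeries.C (X ((I.orderIsoOfFin rfl) i : Fin n))))
      (polyOf (Fnpt (I.card + 1) g)) =
    PowerSeries.coeff g (optS (yLau n σ) (fun i => HahnSeries.C (X i)) I) := by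
  set φ : R (I.card + 1) →+* Lau n := MvPolynomial.eval₂Hom ((HahnSeries.C).comp (algebraMap ℚ (R n)))
      (Fin.cons (yLau n σ)
        (fun i : Fin I.card => HahnSeries.C (X ((I.orderIsoOfFin rfl) i : Fin n)))) with hφ
  let f : Fin (I.card + 1) ↪ Option (Fin n) :=
    ⟨Fin.cons none fun i => some ((I.orderIsoOfFin rfl) i : Fin n), by
      rw [Fin.cons_injective_iff]
      refine ⟨by simp, fun i j hij => ?_⟩
      exact (I.orderIsoOfFin rfl).injective (Subtype.val_injective (Option.some_injective _ hij))⟩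
  have hf : univ.map f = insert none (I.map Function.Embedding.some) := by
    ext o
    simp only [mem_map, mem_univ, true_and, Fin.exists_fin_succ, mem_insert]
    refine or_congr eq_comm ⟨?_, ?_⟩
    · rintro ⟨i, rfl⟩
      exact ⟨_, ((I.orderIsoOfFin rfl) i).2, rfl⟩
    · rintro ⟨a, ha, rfl⟩
      obtain ⟨i, hi⟩ := (I.orderIsoOfFin rfl).surjective ⟨a, ha⟩
      refine ⟨i, ?_⟩
      change some ((I.orderIsoOfFin rfl) i : Fin n) = some a
      rw [hi]
  have hv : ∀ i ∈ univ, (fun o : Option (Fin n) => o.elim (yLau n σ) fun i => HahnSeries.C (X i)) (f i) =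
      φ (X i) := by
    intro i _
    rw [hφ, coe_eval₂Hom, eval₂_X]
    cases i using Fin.cases <;> rfl
  have hs : φ (∑ i, X i) = yLau n σ + HahnSeries.C (∑ i ∈ I, X i) := by
    rw [map_sum, ← Finset.sum_congr rfl hv, ← Finset.sum_map univ f (fun o : Option (Fin n) => o.elim (yLau n σ) fun i =>
      HahnSeries.C (X i)), hf, sum_insert (by simp)]
    simp
  rw [coeff_optS, ← hf, ptH_map φ f X _ univ hv, ← sq_sum_mul_polyOf_Fnpt (Nat.succ_ne_zero _) h,
    map_mul, map_pow, hs]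
  rfl

lemma LExp_two_mul_FExp {n : ℕ} (σ : Bool) (g : ℕ) (I : Finset (Fin n)) :
    LExp σ (∑ i ∈ I, X i) 2 * FExp σ g I =
      PowerSeries.coeff g (optS (yLau n σ) (fun i => HahnSeries.C (X i)) I) := by
  have h2 := LExp_natCast σ (∑ i ∈ I, X i : R n) 2
  rw [Nat.cast_ofNat] at h2
  rw [h2, FExp]
  split_ifs with h0 h1
  · obtain ⟨rfl, hI⟩ := h0
    rw [card_eq_zero] at hI
    subst hI
    rw [coeff_optS, ptH_of_card_eq_one _ (by simp)]
    have hy : (HahnSeries.single (-1 : ℤ) (1 : R n)) ^ 2 * HahnSeries.single 2 1 = 1 := by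
      rw [pow_two, HahnSeries.single_mul_single, HahnSeries.single_mul_single]
      simp
    rw [sum_empty, map_zero, add_zero, yLau, mul_pow, mul_assoc, hy]
    cases σ <;> simp
  · obtain ⟨rfl, hI⟩ := h1
    obtain ⟨i, rfl⟩ := card_eq_one.1 hI
    rw [coeff_zero_optS_singleton]
    have := LExp_neg_one_mul σ (X i : R n)
    simp only [sum_singleton]
    linear_combination (yLau n σ + HahnSeries.C (X i)) * this
  · refine sq_mul_eval₂_polyOf_Fnpt σ g I ?_
    omega

lemma LExp_add_two_mul_FExp {n : ℕ} (σ : Bool) (g α : ℕ) (I : Finset (Fin n)) :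
    LExp σ (∑ i ∈ I, X i) (α + 2) * FExp σ g I =
      PowerSeries.coeff g (powOptS (yLau n σ) (fun i => HahnSeries.C (X i)) α I) := by
  have h2 := LExp_natCast σ (∑ i ∈ I, X i : R n) 2
  have h3 := LExp_natCast σ (∑ i ∈ I, X i : R n) (α + 2)
  push_cast at h2 h3
  rw [powOptS, ← map_pow, PowerSeries.coeff_C_mul, ← LExp_two_mul_FExp, h2, h3, ← map_sum]
  ring

lemma LL_add_two (g n α β : ℕ) : LL g n (α + 2) (β + 2) =
    PowerSeries.coeff g (twoS (yLau n true) (fun i => HahnSeries.C (X i)) α β univ) := by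
  rw [LL, twoS, conv, map_sum, powerset_univ, Finset.sum_comm]
  refine Finset.sum_congr rfl fun I _ => ?_
  rw [PowerSeries.coeff_mul, Nat.sum_antidiagonal_eq_sum_range_succ_mk]
  refine Finset.sum_congr rfl fun k _ => ?_
  have hy : -yLau n true = yLau n false := by
    rw [yLau, yLau, if_pos rfl, if_neg Bool.false_ne_true, one_mul]
    ring_nf
  rw [hy, ← compl_eq_univ_sdiff, ← LExp_add_two_mul_FExp, ← LExp_add_two_mul_FExp]
  ring

/-- The embedding of polynomials in `y` into Laurent series in `y⁻¹`. -/
def polyToLau (n : ℕ) : Polynomial (R n) →+* Lau n :=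
  Polynomial.eval₂RingHom HahnSeries.C (HahnSeries.single (-1) 1)

lemma coeff_polyToLau {n : ℕ} (p : Polynomial (R n)) (k : ℕ) :
    (polyToLau n p).coeff (-(k : ℤ)) = p.coeff k := by
  induction p using Polynomial.induction_on' with
  | add p q hp hq => rw [map_add, HahnSeries.coeff_add, hp, hq, Polynomial.coeff_add]
  | monomial m a =>
    rw [polyToLau, Polynomial.coe_eval₂RingHom, Polynomial.eval₂_monomial, HahnSeries.single_pow,
      HahnSeries.C_mul_eq_smul, HahnSeries.coeff_smul, HahnSeries.coeff_single, 
      Polynomial.coeff_monomial]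
    by_cases h : m = k
    · subst h
      simp
    · have : -(k : ℤ) ≠ m • (-1) := by simp; omega
      rw [if_neg this, if_neg h, smul_zero]

lemma coeff_LL_add_two (g n α β k : ℕ) :
    (LL g n (α + 2) (β + 2)).coeff (-(k : ℤ)) =
      PowerSeries.coeff g (twoC (X : Fin n → R n) α β k univ) := by
  rw [LL_add_two, twoS_map (polyToLau n) Polynomial.X _ (fun i => Polynomial.C (X i)) _ α β univ
    (by simp [polyToLau, yLau]) (fun i _ => by simp [polyToLau]), PowerSeries.coeff_map,
    coeff_polyToLau, twoC, coeff_yc]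

lemma coeff_LL_two_two (g n k : ℕ) :
    (LL g n 2 2).coeff (-(k : ℤ)) =
      PowerSeries.coeff g (twoC (X : Fin n → R n) 0 0 k univ) := by
  rw [← coeff_LL_add_two, Nat.cast_zero, zero_add]

section PolynomialFamily

variable {A : Type*} [CommRing A]

/-- A sequence of power series whose coefficients are polynomials in the index. -/
def IsPolyFamily (f : ℕ → PowerSeries A) : Prop :=
  ∀ k, ∃ q : Polynomial A, ∀ m : ℕ, PowerSeries.coeff k (f m) = q.eval (m : A)

lemma isPolyFamily_const (f : PowerSeries A) : IsPolyFamily fun _ => f :=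
  fun k => ⟨Polynomial.C (PowerSeries.coeff k f), fun m => by rw [Polynomial.eval_C]⟩

lemma IsPolyFamily.mul {f h : ℕ → PowerSeries A} (hf : IsPolyFamily f) (hh : IsPolyFamily h) :
    IsPolyFamily fun m => f m * h m := by
  choose p hp using hf
  choose q hq using hh
  refine fun k => ⟨∑ x ∈ HasAntidiagonal.antidiagonal k, p x.1 * q x.2, fun m => ?_⟩
  simp only [PowerSeries.coeff_mul, hp, hq, Polynomial.eval_finsetSum, Polynomial.eval_mul]

lemma IsPolyFamily.exists_ofPowerSeries_mul {f : ℕ → PowerSeries A} (hf : IsPolyFamily f)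
    (w : LaurentSeries A) (k : ℤ) : ∃ q : Polynomial A, ∀ m : ℕ,
      (HahnSeries.ofPowerSeries ℤ A (f m) * w).coeff k = q.eval (m : A) := by
  have hw : ∀ m, (HahnSeries.ofPowerSeries ℤ A (f m) * w).coeff k =
      (HahnSeries.ofPowerSeries ℤ A (f m * w.powerSeriesPart)).coeff (k - w.order) := fun m => by
    conv_lhs => rw [← LaurentSeries.single_order_mul_powerSeriesPart w]
    rw [mul_left_comm, ← map_mul]
    have := HahnSeries.coeff_single_mul_add (r := (1 : A))
      (x := HahnSeries.ofPowerSeries ℤ A (f m * w.powerSeriesPart)) (a := k - w.order)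
      (b := w.order)
    rwa [sub_add_cancel, one_mul] at this
  by_cases hk : 0 ≤ k - w.order
  · obtain ⟨j, hj⟩ := Int.eq_ofNat_of_zero_le hk
    obtain ⟨q, hq⟩ := hf.mul (isPolyFamily_const w.powerSeriesPart) j
    exact ⟨q, fun m => by rw [hw, hj, ← hq, HahnSeries.ofPowerSeries_apply_coeff]⟩
  · refine ⟨0, fun m => ?_⟩
    rw [hw, Polynomial.eval_zero, PowerSeries.coeff_coe, if_pos (by omega)]

end PolynomialFamily

lemma isPolyFamily_binomZ {n : ℕ} (c : R n) : IsPolyFamily fun m =>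
    PowerSeries.mk fun k => MvPolynomial.C (binomZ (2 * m : ℕ) k) * c ^ k := by
  intro k
  refine ⟨Polynomial.C (MvPolynomial.C (1 / (k.factorial : ℚ)) * c ^ k) *
    ∏ i ∈ range k, (2 * Polynomial.X - (i : Polynomial (R n))), fun m => ?_⟩
  rw [PowerSeries.coeff_mk, binomZ, Polynomial.eval_mul, Polynomial.eval_C, Polynomial.eval_prod,
    div_eq_mul_one_div, map_mul, map_prod]
  have h2 : (MvPolynomial.C 2 : R n) = 2 := map_ofNat _ 2
  simp [h2]
  rw [mul_assoc, mul_comm]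

lemma LExp_two_mul {n : ℕ} (σ : Bool) (c : R n) (m : ℕ) :
    LExp σ c (2 * m : ℕ) = HahnSeries.single (-(2 * m : ℤ)) 1 *
      HahnSeries.ofPowerSeries ℤ (R n) (PowerSeries.mk fun k =>
        MvPolynomial.C (binomZ (2 * m : ℕ) k) * ((if σ then 1 else -1 : R n) * c) ^ k) := by
  have h : Even (((2 * m : ℕ)) : ℤ) := by simp
  rw [LExp, yExpAdd, if_pos h]
  simp

lemma exists_coeff_LL (g n : ℕ) (k : ℤ) : ∃ q : Polynomial (R n), ∀ m : ℕ,
    (LL g n (2 * m : ℕ) (2 * m : ℕ)).coeff (k - 4 * m) = q.eval (m : R n) := by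
  have h : ∀ (gp : ℕ) (I : Finset (Fin n)), ∃ q : Polynomial (R n), ∀ m : ℕ,
      (LExp true (∑ i ∈ I, X i) (2 * m : ℕ) * LExp false (∑ i ∈ Iᶜ, X i) (2 * m : ℕ) *
        FExp true gp I * FExp false (g - gp) Iᶜ).coeff (k - 4 * m) = q.eval (m : R n) := by
    intro gp I
    obtain ⟨q, hq⟩ := ((isPolyFamily_binomZ ((if true then 1 else -1 : R n) * ∑ i ∈ I, X i)).mul
      (isPolyFamily_binomZ ((if false then 1 else -1 : R n) * ∑ i ∈ Iᶜ, X i))).exists_ofPowerSeries_mul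
        (FExp true gp I * FExp false (g - gp) Iᶜ) k
    refine ⟨q, fun m => ?_⟩
    rw [← hq, LExp_two_mul, LExp_two_mul, map_mul]
    set P := HahnSeries.ofPowerSeries ℤ (R n) (PowerSeries.mk fun k =>
        MvPolynomial.C (binomZ (2 * m : ℕ) k) * ((if true then 1 else -1 : R n) * ∑ i ∈ I, X i) ^ k)
    set Q := HahnSeries.ofPowerSeries ℤ (R n) (PowerSeries.mk fun k =>
        MvPolynomial.C (binomZ (2 * m : ℕ) k) * ((if false then 1 else -1 : R n) * ∑ i ∈ Iᶜ, X i) ^ k)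
    have hs : (HahnSeries.single (-(2 * m : ℤ)) (1 : R n)) * HahnSeries.single (-(2 * m : ℤ)) 1 =
        HahnSeries.single (-(4 * m : ℤ)) 1 := by
      rw [HahnSeries.single_mul_single, one_mul]
      congr 1
      ring_nf
    have := HahnSeries.coeff_single_mul_add (r := (1 : R n))
      (x := P * Q * (FExp true gp I * FExp false (g - gp) Iᶜ)) (a := k) (b := -(4 * m : ℤ))
    rw [one_mul, ← hs, ← sub_eq_add_neg] at this
    rw [← this]
    congr 1
    ring
  choose q hq using h
  refine ⟨∑ gp ∈ range (g + 1), ∑ I : Finset (Fin n), q gp I, fun m => ?_⟩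
  simp only [LL, HahnSeries.coeff_sum, Polynomial.eval_finsetSum, hq]

lemma coeff_LL_zero_zero (g n : ℕ) : (LL g n 0 0).coeff (-(2 * (g : ℤ) - 2)) = 0 := by
  obtain ⟨q, hq⟩ := exists_coeff_LL g n (-(2 * (g : ℤ) - 2))
  have hq1 : ∀ m : ℕ, q.eval ((m + 1 : ℕ) : R n) = 0 := fun m => by
    rw [← hq, show ((2 * (m + 1) : ℕ) : ℤ) = (2 * m : ℕ) + 2 by push_cast; ring,
      show -(2 * (g : ℤ) - 2) - 4 * (m + 1 : ℕ) = -((2 * g + 4 * m + 2 : ℕ) : ℤ) by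
        push_cast; ring, coeff_LL_add_two]
    exact coeff_twoC_eq_zero _ _ _ _ _ _ (by omega)
  have hq0 : q = 0 := by
    refine Polynomial.eq_zero_of_infinite_isRoot q (Set.Infinite.mono ?_
      (Set.infinite_range_of_injective (f := fun m : ℕ => ((m + 1 : ℕ) : R n)) ?_))
    · rintro _ ⟨m, rfl⟩
      exact hq1 m
    · intro a b hab
      simpa using hab
  have := hq 0
  simpa [hq0] using this

/-- The three statements of Proposition 3.1:
(i) `[L_g^{0,0}(y,x)]_{y^{2g−2}} = 0`;
(ii) `[L_g^{2,2}(y,x)]_{y^k} = 0` for `k > 2g`;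
(iii) `[L_g^{2,2}(y,x)]_{y^{2g} Π x_j^{d_j}} = (2g+n+1)!/(4^g(2g+1)! Π (2d_j−1)!!)`
for `d_j ≥ 1` with `Σ d_j = g + n`. -/
theorem proposition_3_1 (g n : ℕ) (hn : 1 ≤ n) :
    (∀ d : Fin n → ℕ, coeffL (LL g n 0 0) (2*(g : ℤ) - 2) d = 0) ∧
    (∀ k : ℤ, 2*(g : ℤ) < k → ∀ d : Fin n → ℕ, coeffL (LL g n 2 2) k d = 0) ∧
    (∀ d : Fin n → ℕ, (∀ j, 1 ≤ d j) → (∑ j, d j = g + n) →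
      coeffL (LL g n 2 2) (2*(g : ℤ)) d
        = ((2*g+n+1).factorial : ℚ) /
            (4^g * ((2*g+1).factorial : ℚ) * ∏ j, (Nat.doubleFactorial (2*(d j)-1) : ℚ))) := by
  refine ⟨fun d => ?_, fun k hk d => ?_, fun d hd hsum => ?_⟩
  · rw [coeffL, coeff_LL_zero_zero, MvPolynomial.coeff_zero]
  · obtain ⟨k, rfl⟩ := Int.eq_ofNat_of_zero_le (show 0 ≤ k by omega)
    rw [coeffL, coeff_LL_two_two, coeff_twoC_eq_zero _ _ _ _ _ _ (by omega),
      MvPolynomial.coeff_zero]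
  · have h := coeff_leadC 0 0 g univ (Finsupp.equivFunOnFinite.symm d) (fun i _ => hd i)
      (fun i hi => absurd (mem_univ i) hi) (by simpa using hsum)
    have hc := coeff_LL_two_two g n (2 * g)
    push_cast at hc
    simp only [leadC, add_zero, pow_zero, one_mul, card_univ, Fintype.card_fin,
      Finsupp.equivFunOnFinite_symm_apply_apply] at h
    have hfac : ((2 * g + 1).factorial : ℚ) ≠ 0 := by exact_mod_cast Nat.factorial_ne_zero _
    have hdf : ∏ j, (Nat.doubleFactorial (2 * d j - 1) : ℚ) ≠ 0 :=
      Finset.prod_ne_zero_iff.2 fun j _ => by exact_mod_cast (Nat.doubleFactorial_pos _).ne'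
    rw [coeffL, hc, eq_div_iff (by positivity), show 2 * g + n + 1 = 2 * g + 1 + n by ring, ← h]
    ring

end
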